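/- arXiv:1409.0711 — 6 statements merged into one kernel-verified Lean document; each statement's English description precedes it below -/
import Mathlib

section
/- Let G = (V,E) be a connected simple graph on N ≥ 2 vertices, Ψ a potential on V and β > 0. Let ρ* be the Gibbs distribution and let ρ(t) : [0,∞) → M be a solution of Fokker–Planck equation I with initial value ρ⁰ ∈ M. Then there exists a constant C > 0 (depending on ρ⁰, G, Ψ and β) such that for all t ≥ 0: ||ρ(t)/ρ* − 1||²_{2,ρ*} ≤ ||ρ⁰/ρ* − 1||²_{2,ρ*} · e^{−Ct}. In particular ρ(t) converges exponentially to ρ* in the Euclidean metric of ℝ^N as t → ∞. -/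
/-!
STATEMENT 0: Exponential convergence in weighted L² norm for solutions of
Fokker–Planck equation I on a connected simple graph.
-/

open Finset Real

/-- `ρ` is a positive probability distribution on the `N` vertices. -/
def IsProbDist {N : ℕ} (ρ : Fin N → ℝ) : Prop :=
  (∀ i, 0 < ρ i) ∧ ∑ i, ρ i = 1

/-- The Gibbs distribution `ρ*_i = e^{-Ψ_i/β} / Σ_j e^{-Ψ_j/β}`. -/
noncomputable def gibbs {N : ℕ} (Ψ : Fin N → ℝ) (β : ℝ) (i : Fin N) : ℝ :=
  Real.exp (-Ψ i / β) / ∑ j, Real.exp (-Ψ j / β)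

/-- Right hand side of Fokker–Planck equation I. -/
noncomputable def fpe1RHS {N : ℕ} (G : SimpleGraph (Fin N)) [DecidableRel G.Adj]
    (Ψ : Fin N → ℝ) (β : ℝ) (ρ : Fin N → ℝ) (i : Fin N) : ℝ :=
  (∑ j, if G.Adj i j ∧ Ψ i < Ψ j then
      ((Ψ j + β * Real.log (ρ j)) - (Ψ i + β * Real.log (ρ i))) * ρ j else 0)
  + (∑ j, if G.Adj i j ∧ Ψ j < Ψ i then
      ((Ψ j + β * Real.log (ρ j)) - (Ψ i + β * Real.log (ρ i))) * ρ i else 0)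
  + (∑ j, if G.Adj i j ∧ Ψ j = Ψ i then β * (ρ j - ρ i) else 0)

/-- `ρ : [0,∞) → M` is a solution of Fokker–Planck equation I. -/
def IsFPE1Sol {N : ℕ} (G : SimpleGraph (Fin N)) [DecidableRel G.Adj]
    (Ψ : Fin N → ℝ) (β : ℝ) (ρ : ℝ → Fin N → ℝ) : Prop :=
  (∀ t, 0 ≤ t → IsProbDist (ρ t)) ∧
  ∀ t, 0 ≤ t → ∀ i,
    HasDerivWithinAt (fun s => ρ s i) (fpe1RHS G Ψ β (ρ t) i) (Set.Ici 0) t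

/-- Squared weighted `L²` distance `‖ν/μ - 1‖²_{2,μ}`. -/
noncomputable def wL2sq {N : ℕ} (ν μ : Fin N → ℝ) : ℝ :=
  ∑ i, (ν i / μ i - 1) ^ 2 * μ i

/-- The oriented flux along the edge from `j` to `i` in Fokker–Planck equation I. -/
noncomputable def fpe1Flux {N : ℕ} (Ψ : Fin N → ℝ) (β : ℝ) (ρ : Fin N → ℝ) (i j : Fin N) : ℝ :=
  if Ψ i < Ψ j then ((Ψ j + β * Real.log (ρ j)) - (Ψ i + β * Real.log (ρ i))) * ρ j
  else if Ψ j < Ψ i then ((Ψ j + β * Real.log (ρ j)) - (Ψ i + β * Real.log (ρ i))) * ρ i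
  else β * (ρ j - ρ i)

/-- The (unweighted) Dirichlet form of the graph `G`, summed over ordered pairs. -/
noncomputable def dirichletForm {N : ℕ} (G : SimpleGraph (Fin N)) [DecidableRel G.Adj]
    (h : Fin N → ℝ) : ℝ :=
  ∑ i, ∑ j, if G.Adj i j then (h j - h i) ^ 2 else 0

theorem gibbs_pos {N : ℕ} (Ψ : Fin N → ℝ) (β : ℝ) (i : Fin N) : 0 < gibbs Ψ β i :=
  div_pos (Real.exp_pos _) (Finset.sum_pos (fun _ _ => Real.exp_pos _) ⟨i, Finset.mem_univ i⟩)

theorem sum_gibbs {N : ℕ} (hN : 2 ≤ N) (Ψ : Fin N → ℝ) (β : ℝ) : ∑ i, gibbs Ψ β i = 1 := by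
  have hpos : 0 < ∑ j, Real.exp (-Ψ j / β) :=
    Finset.sum_pos (fun _ _ => Real.exp_pos _) ⟨⟨0, by omega⟩, Finset.mem_univ _⟩
  simp only [gibbs]
  rw [← Finset.sum_div, div_self hpos.ne']

theorem isProbDist_gibbs {N : ℕ} (hN : 2 ≤ N) (Ψ : Fin N → ℝ) (β : ℝ) :
    IsProbDist (gibbs Ψ β) :=
  ⟨gibbs_pos Ψ β, sum_gibbs hN Ψ β⟩

theorem fpe1RHS_eq_sum_fpe1Flux {N : ℕ} (G : SimpleGraph (Fin N)) [DecidableRel G.Adj]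
    (Ψ : Fin N → ℝ) (β : ℝ) (ρ : Fin N → ℝ) (i : Fin N) :
    fpe1RHS G Ψ β ρ i = ∑ j, if G.Adj i j then fpe1Flux Ψ β ρ i j else 0 := by
  rw [fpe1RHS, ← Finset.sum_add_distrib, ← Finset.sum_add_distrib]
  refine Finset.sum_congr rfl fun j _ => ?_
  by_cases hadj : G.Adj i j
  · rcases lt_trichotomy (Ψ i) (Ψ j) with h | h | h
    · simp [fpe1Flux, hadj, h, h.not_gt, h.ne']
    · simp [fpe1Flux, hadj, h]
    · simp [fpe1Flux, hadj, h, h.not_gt, h.ne]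
  · simp [hadj]

theorem fpe1Flux_swap {N : ℕ} (Ψ : Fin N → ℝ) (β : ℝ) (ρ : Fin N → ℝ) (i j : Fin N) :
    fpe1Flux Ψ β ρ j i = -fpe1Flux Ψ β ρ i j := by
  rcases lt_trichotomy (Ψ i) (Ψ j) with h | h | h
  · simp only [fpe1Flux, h, h.not_gt, if_true, if_false]; ring
  · simp only [fpe1Flux, h, lt_irrefl, if_false]; ring
  · simp only [fpe1Flux, h, h.not_gt, if_true, if_false]; ring

/-- Summation by parts against the right-hand side of Fokker–Planck equation I. -/
theorem sum_mul_fpe1RHS {N : ℕ} (G : SimpleGraph (Fin N)) [DecidableRel G.Adj]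
    (Ψ : Fin N → ℝ) (β : ℝ) (ρ a : Fin N → ℝ) :
    ∑ i, a i * fpe1RHS G Ψ β ρ i =
      -(1 / 2) * ∑ i, ∑ j, if G.Adj i j then (a j - a i) * fpe1Flux Ψ β ρ i j else 0 := by
  have h1 : ∑ i, a i * fpe1RHS G Ψ β ρ i =
      ∑ i, ∑ j, if G.Adj i j then a i * fpe1Flux Ψ β ρ i j else 0 := by
    simp only [fpe1RHS_eq_sum_fpe1Flux, Finset.mul_sum, mul_ite, mul_zero]
  have h2 : ∑ i, a i * fpe1RHS G Ψ β ρ i =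
      -∑ i, ∑ j, if G.Adj i j then a j * fpe1Flux Ψ β ρ i j else 0 := by
    rw [h1, Finset.sum_comm, ← Finset.sum_neg_distrib]
    refine Finset.sum_congr rfl fun i _ => ?_
    rw [← Finset.sum_neg_distrib]
    refine Finset.sum_congr rfl fun j _ => ?_
    simp only [fpe1Flux_swap Ψ β ρ i j, G.adj_comm j i]
    split_ifs <;> ring
  have h3 : (∑ i, ∑ j, if G.Adj i j then (a j - a i) * fpe1Flux Ψ β ρ i j else 0) =
      (∑ i, ∑ j, if G.Adj i j then a j * fpe1Flux Ψ β ρ i j else 0) -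
        ∑ i, ∑ j, if G.Adj i j then a i * fpe1Flux Ψ β ρ i j else 0 := by
    simp only [← Finset.sum_sub_distrib]
    refine Finset.sum_congr rfl fun i _ => Finset.sum_congr rfl fun j _ => ?_
    split_ifs <;> ring
  rw [h3, ← h1]
  linarith

theorem exists_log_sub_log_eq_mul_sub {a b H : ℝ} (ha : 0 < a) (hb : 0 < b) (haH : a ≤ H)
    (hbH : b ≤ H) : ∃ k, 1 / H ≤ k ∧ Real.log a - Real.log b = k * (a - b) := by
  wlog hab : b ≤ a generalizing a b
  · obtain ⟨k, hk, hkab⟩ := this hb ha hbH haH (le_of_not_ge hab)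
    exact ⟨k, hk, by linarith⟩
  rcases hab.eq_or_lt with rfl | hlt
  · exact ⟨1 / H, le_rfl, by ring⟩
  have hsub : 0 < a - b := sub_pos.2 hlt
  refine ⟨(Real.log a - Real.log b) / (a - b), ?_, (div_mul_cancel₀ _ hsub.ne').symm⟩
  have hlog := Real.one_sub_inv_le_log_of_pos (div_pos ha hb)
  rw [Real.log_div ha.ne' hb.ne', inv_div] at hlog
  have h1 : 1 / a ≤ (Real.log a - Real.log b) / (a - b) := by
    rw [le_div_iff₀ hsub]
    calc 1 / a * (a - b) = 1 - b / a := by field_simp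
      _ ≤ _ := hlog
  exact (one_div_le_one_div_of_le ha haH).trans h1

theorem log_gibbs_add {N : ℕ} (Ψ : Fin N → ℝ) {β : ℝ} (hβ : 0 < β) (i : Fin N) :
    Ψ i + β * Real.log (gibbs Ψ β i) = -(β * Real.log (∑ j, Real.exp (-Ψ j / β))) := by
  have hpos : 0 < ∑ j, Real.exp (-Ψ j / β) :=
    Finset.sum_pos (fun _ _ => Real.exp_pos _) ⟨i, Finset.mem_univ _⟩
  rw [gibbs, Real.log_div (Real.exp_pos _).ne' hpos.ne', Real.log_exp]
  field_simp
  ring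

/-- The flux is a positive multiple of the difference of the relative densities `ρ / ρ*`. -/
theorem exists_fpe1Flux_eq_mul_sub {N : ℕ} (Ψ : Fin N → ℝ) {β : ℝ} (hβ : 0 < β)
    (ρ : Fin N → ℝ) (i j : Fin N) {m H δ : ℝ} (hm : 0 < m) (hδ : 0 < δ)
    (hδi : δ ≤ gibbs Ψ β i) (hδj : δ ≤ gibbs Ψ β j)
    (hmi : m ≤ ρ i / gibbs Ψ β i) (hmj : m ≤ ρ j / gibbs Ψ β j)
    (hiH : ρ i / gibbs Ψ β i ≤ H) (hjH : ρ j / gibbs Ψ β j ≤ H) :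
    ∃ k, β * (m * δ) / H ≤ k ∧
      fpe1Flux Ψ β ρ i j = k * (ρ j / gibbs Ψ β j - ρ i / gibbs Ψ β i) := by
  have hHm : m ≤ H := hmi.trans hiH
  have hH : 0 < H := hm.trans_le hHm
  have key : ∀ l, m ≤ ρ l / gibbs Ψ β l → δ ≤ gibbs Ψ β l →
      m * δ ≤ ρ l ∧ Ψ l + β * Real.log (ρ l) =
        β * Real.log (ρ l / gibbs Ψ β l) - β * Real.log (∑ j, Real.exp (-Ψ j / β)) := by
    intro l hml hδl
    have hg := gibbs_pos Ψ β l
    have hge : m * δ ≤ ρ l :=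
      (mul_le_mul_of_nonneg_left hδl hm.le).trans ((le_div_iff₀ hg).1 hml)
    have hρl : 0 < ρ l := (mul_pos hm hδ).trans_le hge
    refine ⟨hge, ?_⟩
    rw [Real.log_div hρl.ne' hg.ne']
    linarith [log_gibbs_add Ψ hβ l]
  obtain ⟨hρi, hlogi⟩ := key i hmi hδi
  obtain ⟨hρj, hlogj⟩ := key j hmj hδj
  obtain ⟨k, hk, hkeq⟩ := exists_log_sub_log_eq_mul_sub (hm.trans_le hmj) (hm.trans_le hmi) hjH hiH
  have hlog : (Ψ j + β * Real.log (ρ j)) - (Ψ i + β * Real.log (ρ i)) =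
      β * (k * (ρ j / gibbs Ψ β j - ρ i / gibbs Ψ β i)) := by
    rw [hlogi, hlogj, ← hkeq]; ring
  have hbound : ∀ r, m * δ ≤ r → β * (m * δ) / H ≤ β * k * r := by
    intro r hr
    have hk0 : 0 ≤ k := le_trans (by positivity) hk
    have hβk : 0 ≤ β * k := by positivity
    calc β * (m * δ) / H = β * (1 / H) * (m * δ) := by ring
      _ ≤ β * k * r := by gcongr
  rw [fpe1Flux, hlog]
  split_ifs with h1 h2
  · exact ⟨β * k * ρ j, hbound _ hρj, by ring⟩
  · exact ⟨β * k * ρ i, hbound _ hρi, by ring⟩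
  · have hΨ : Ψ i = Ψ j := le_antisymm (not_lt.1 h2) (not_lt.1 h1)
    have hgij : gibbs Ψ β j = gibbs Ψ β i := by simp only [gibbs, hΨ]
    refine ⟨β * gibbs Ψ β i, ?_, ?_⟩
    · have hβg : 0 ≤ β * gibbs Ψ β i := mul_nonneg hβ.le (gibbs_pos Ψ β i).le
      rw [div_le_iff₀ hH]
      calc β * (m * δ) = β * δ * m := by ring
        _ ≤ β * gibbs Ψ β i * H := by gcongr
    · have hg := (gibbs_pos Ψ β i).ne'
      rw [hgij]
      field_simp

theorem fpe1Flux_mul_sub_nonneg_of_monotone {N : ℕ} (Ψ : Fin N → ℝ) {β : ℝ} (hβ : 0 < β)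
    {ρ : Fin N → ℝ} (hρ : ∀ i, 0 < ρ i) {f : ℝ → ℝ} (hf : Monotone f) (i j : Fin N) :
    0 ≤ (f (ρ j / gibbs Ψ β j) - f (ρ i / gibbs Ψ β i)) * fpe1Flux Ψ β ρ i j := by
  have hgi := gibbs_pos Ψ β i
  have hgj := gibbs_pos Ψ β j
  have hi := div_pos (hρ i) hgi
  have hj := div_pos (hρ j) hgj
  have hmin := lt_min hi hj
  have hmax := hi.trans_le (le_max_left _ (ρ j / gibbs Ψ β j))
  have hg := lt_min hgi hgj
  obtain ⟨k, hk, hflux⟩ := exists_fpe1Flux_eq_mul_sub Ψ hβ ρ i j hmin hg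
    (min_le_left _ _) (min_le_right _ _) (min_le_left _ _) (min_le_right _ _)
    (le_max_left _ _) (le_max_right _ _)
  have hk0 : 0 ≤ k := le_trans (by positivity) hk
  rw [hflux]
  rcases le_total (ρ i / gibbs Ψ β i) (ρ j / gibbs Ψ β j) with h | h
  · exact mul_nonneg (sub_nonneg.2 (hf h)) (mul_nonneg hk0 (sub_nonneg.2 h))
  · exact mul_nonneg_of_nonpos_of_nonpos (sub_nonpos.2 (hf h))
      (mul_nonpos_of_nonneg_of_nonpos hk0 (sub_nonpos.2 h))

theorem dirichletForm_nonneg {N : ℕ} (G : SimpleGraph (Fin N)) [DecidableRel G.Adj]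
    (h : Fin N → ℝ) : 0 ≤ dirichletForm G h :=
  Finset.sum_nonneg fun i _ => Finset.sum_nonneg fun j _ => by split_ifs <;> positivity

theorem sq_sub_le_dirichletForm {N : ℕ} {G : SimpleGraph (Fin N)} [DecidableRel G.Adj]
    (h : Fin N → ℝ) {i j : Fin N} (hij : G.Adj i j) : (h j - h i) ^ 2 ≤ dirichletForm G h := by
  have h1 : (h j - h i) ^ 2 ≤ ∑ l, if G.Adj i l then (h l - h i) ^ 2 else 0 := by
    have := Finset.single_le_sum (f := fun l => if G.Adj i l then (h l - h i) ^ 2 else 0)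
      (fun l _ => by split_ifs <;> positivity) (Finset.mem_univ j)
    simpa [hij] using this
  exact h1.trans (Finset.single_le_sum
    (f := fun i => ∑ l, if G.Adj i l then (h l - h i) ^ 2 else 0)
    (fun i _ => Finset.sum_nonneg fun l _ => by split_ifs <;> positivity) (Finset.mem_univ i))

theorem exists_sq_sub_le_mul_dirichletForm {N : ℕ} {G : SimpleGraph (Fin N)}
    [DecidableRel G.Adj] {i j : Fin N} (hij : G.Reachable i j) :
    ∃ K, 0 ≤ K ∧ ∀ h : Fin N → ℝ, (h j - h i) ^ 2 ≤ K * dirichletForm G h := by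
  obtain ⟨w⟩ := hij
  induction w with
  | nil => exact ⟨0, le_rfl, fun h => by simp⟩
  | @cons u v w huv _ ih =>
    obtain ⟨K, hK, hle⟩ := ih
    refine ⟨2 * K + 2, by positivity, fun h => ?_⟩
    nlinarith [hle h, sq_sub_le_dirichletForm h huv, sq_nonneg ((h w - h v) - (h v - h u))]

/-- Poincaré inequality on a connected graph. -/
theorem exists_wL2sq_le_mul_dirichletForm {N : ℕ} (hN : 2 ≤ N) {G : SimpleGraph (Fin N)}
    [DecidableRel G.Adj] (hG : G.Connected) {μ : Fin N → ℝ} (hμ : IsProbDist μ) :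
    ∃ K, 0 < K ∧ ∀ ν : Fin N → ℝ, ∑ i, ν i = 1 →
      wL2sq ν μ ≤ K * dirichletForm G fun i => ν i / μ i := by
  let o : Fin N := ⟨0, by omega⟩
  choose K hK hle using fun j => exists_sq_sub_le_mul_dirichletForm (G := G) (hG.preconnected o j)
  refine ⟨∑ j, K j * μ j + 1, ?_, fun ν hν => ?_⟩
  · have : 0 ≤ ∑ j, K j * μ j := Finset.sum_nonneg fun j _ => mul_nonneg (hK j) (hμ.1 j).le
    linarith
  set h : Fin N → ℝ := fun i => ν i / μ i with hh
  have hmul : ∀ j, h j * μ j = ν j := fun j => div_mul_cancel₀ _ (hμ.1 j).ne'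
  have hexp : ∑ j, (h j - h o) ^ 2 * μ j = wL2sq ν μ + (1 - h o) ^ 2 := by
    have hterm : ∀ j, (h j - h o) ^ 2 * μ j = (h j - 1) ^ 2 * μ j +
        (2 * (1 - h o) * (ν j - μ j) + (1 - h o) ^ 2 * μ j) := by
      intro j
      rw [← hmul j]
      ring
    simp only [hterm, Finset.sum_add_distrib, ← Finset.mul_sum, Finset.sum_sub_distrib, hν, hμ.2]
    simp only [wL2sq, hh]
    ring
  calc wL2sq ν μ ≤ ∑ j, (h j - h o) ^ 2 * μ j := by
        rw [hexp]; linarith [sq_nonneg (1 - h o)]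
    _ ≤ ∑ j, K j * dirichletForm G h * μ j :=
        Finset.sum_le_sum fun j _ => mul_le_mul_of_nonneg_right (hle j h) (hμ.1 j).le
    _ = (∑ j, K j * μ j) * dirichletForm G h := by
        rw [Finset.sum_mul]
        exact Finset.sum_congr rfl fun j _ => by ring
    _ ≤ (∑ j, K j * μ j + 1) * dirichletForm G h :=
        mul_le_mul_of_nonneg_right (by linarith) (dirichletForm_nonneg G h)

theorem antitoneOn_Ici_of_hasDerivWithinAt_nonpos {f f' : ℝ → ℝ} {a : ℝ}
    (hf : ∀ t, a ≤ t → HasDerivWithinAt f (f' t) (Set.Ici a) t)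
    (hf' : ∀ t, a ≤ t → f' t ≤ 0) : AntitoneOn f (Set.Ici a) :=
  antitoneOn_of_hasDerivWithinAt_nonpos (convex_Ici a)
    (fun t ht => (hf t ht).continuousWithinAt)
    (fun t ht => (hf t (interior_subset ht)).mono interior_subset)
    (fun t ht => hf' t (interior_subset ht))

theorem le_mul_exp_of_hasDerivWithinAt_le {f f' : ℝ → ℝ} {C : ℝ}
    (hf : ∀ t, 0 ≤ t → HasDerivWithinAt f (f' t) (Set.Ici 0) t)
    (hf' : ∀ t, 0 ≤ t → f' t ≤ -C * f t) {t : ℝ} (ht : 0 ≤ t) :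
    f t ≤ f 0 * Real.exp (-C * t) := by
  have hanti : AntitoneOn (fun s => f s * Real.exp (C * s)) (Set.Ici 0) := by
    refine antitoneOn_Ici_of_hasDerivWithinAt_nonpos
      (f' := fun s => f' s * Real.exp (C * s) + f s * (Real.exp (C * s) * (C * 1)))
      (fun s hs => (hf s hs).mul
        (((hasDerivAt_id s).const_mul C).exp.hasDerivWithinAt)) fun s hs => ?_
    nlinarith [hf' s hs, Real.exp_pos (C * s)]
  have h := hanti Set.self_mem_Ici ht ht
  simp only [mul_zero, Real.exp_zero, mul_one] at h
  calc f t = f t * Real.exp (C * t) * Real.exp (-C * t) := by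
        rw [mul_assoc, ← Real.exp_add]; simp
    _ ≤ f 0 * Real.exp (-C * t) := mul_le_mul_of_nonneg_right h (Real.exp_pos _).le

theorem hasDerivAt_max_sub_zero_sq (m x : ℝ) :
    HasDerivAt (fun y => (max (m - y) 0) ^ 2) (-(2 * max (m - x) 0)) x := by
  rw [hasDerivAt_iff_isLittleO]
  refine Asymptotics.IsBigO.trans_isLittleO (g := fun y => (y - x) ^ 2) ?_ ?_
  · refine Asymptotics.IsBigO.of_bound 1 (Filter.Eventually.of_forall fun y => ?_)
    rw [Real.norm_eq_abs, Real.norm_eq_abs, abs_of_nonneg (sq_nonneg (y - x)), one_mul, abs_le,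
      smul_eq_mul]
    rcases max_cases (m - y) 0 with ⟨h1, h1'⟩ | ⟨h1, h1'⟩ <;>
      rcases max_cases (m - x) 0 with ⟨h2, h2'⟩ | ⟨h2, h2'⟩ <;> rw [h1, h2] <;>
      constructor <;> nlinarith
  · simpa only [Real.norm_eq_abs, sq_abs] using
      Asymptotics.isLittleO_pow_sub_sub x one_lt_two

/-- Evolution of `∑ φ(ρ_i / ρ*_i) ρ*_i` along a solution of Fokker–Planck equation I. -/
theorem IsFPE1Sol.hasDerivWithinAt_sum {N : ℕ} {G : SimpleGraph (Fin N)} [DecidableRel G.Adj]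
    {Ψ : Fin N → ℝ} {β : ℝ} {ρ : ℝ → Fin N → ℝ} (hsol : IsFPE1Sol G Ψ β ρ) {φ φ' : ℝ → ℝ}
    (hφ : ∀ x, HasDerivAt φ (φ' x) x) {t : ℝ} (ht : 0 ≤ t) :
    HasDerivWithinAt (fun s => ∑ i, φ (ρ s i / gibbs Ψ β i) * gibbs Ψ β i)
      (-(1 / 2) * ∑ i, ∑ j, if G.Adj i j then
        (φ' (ρ t j / gibbs Ψ β j) - φ' (ρ t i / gibbs Ψ β i)) * fpe1Flux Ψ β (ρ t) i j else 0)
      (Set.Ici 0) t := by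
  rw [← sum_mul_fpe1RHS G Ψ β (ρ t) fun i => φ' (ρ t i / gibbs Ψ β i)]
  refine HasDerivWithinAt.fun_sum fun i _ => ?_
  have h := ((hφ (ρ t i / gibbs Ψ β i)).comp_hasDerivWithinAt t
    ((hsol.2 t ht i).div_const (gibbs Ψ β i))).mul_const (gibbs Ψ β i)
  refine h.congr_deriv ?_
  have := (gibbs_pos Ψ β i).ne'
  field_simp

/-- Minimum principle for the relative density `ρ / ρ*`. -/
theorem IsFPE1Sol.le_div_gibbs {N : ℕ} {G : SimpleGraph (Fin N)} [DecidableRel G.Adj]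
    {Ψ : Fin N → ℝ} {β : ℝ} (hβ : 0 < β) {ρ : ℝ → Fin N → ℝ} (hsol : IsFPE1Sol G Ψ β ρ) {m : ℝ}
    (hm : ∀ i, m ≤ ρ 0 i / gibbs Ψ β i) {t : ℝ} (ht : 0 ≤ t) (i : Fin N) :
    m ≤ ρ t i / gibbs Ψ β i := by
  have hmono : Monotone fun x : ℝ => -(2 * max (m - x) 0) := by
    intro x y hxy
    have : max (m - y) 0 ≤ max (m - x) 0 := max_le_max (by linarith) le_rfl
    simp only
    linarith
  have hanti := antitoneOn_Ici_of_hasDerivWithinAt_nonpos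
    (fun t ht => hsol.hasDerivWithinAt_sum (hasDerivAt_max_sub_zero_sq m) ht) fun t ht => by
      refine mul_nonpos_of_nonpos_of_nonneg (by norm_num) <|
        Finset.sum_nonneg fun i _ => Finset.sum_nonneg fun j _ => ?_
      split_ifs
      · exact fpe1Flux_mul_sub_nonneg_of_monotone Ψ hβ (hsol.1 t ht).1 hmono i j
      · exact le_rfl
  have hle := hanti Set.self_mem_Ici ht ht
  have hzero : ∑ i, (max (m - ρ 0 i / gibbs Ψ β i) 0) ^ 2 * gibbs Ψ β i = 0 :=
    Finset.sum_eq_zero fun i _ => by rw [max_eq_right (sub_nonpos.2 (hm i))]; ring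
  have hsingle := Finset.single_le_sum
    (f := fun i => (max (m - ρ t i / gibbs Ψ β i) 0) ^ 2 * gibbs Ψ β i)
    (fun i _ => mul_nonneg (sq_nonneg _) (gibbs_pos Ψ β i).le) (Finset.mem_univ i)
  have hnonpos : (max (m - ρ t i / gibbs Ψ β i) 0) ^ 2 * gibbs Ψ β i ≤ 0 :=
    (hsingle.trans hle).trans hzero.le
  by_contra! hlt
  have hpos : 0 < max (m - ρ t i / gibbs Ψ β i) 0 := lt_max_of_lt_left (sub_pos.2 hlt)
  have := mul_pos (pow_pos hpos 2) (gibbs_pos Ψ β i)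
  linarith

theorem sq_sub_le_wL2sq {N : ℕ} {μ : Fin N → ℝ} (hμ : IsProbDist μ) (ν : Fin N → ℝ) (i : Fin N) :
    (ν i - μ i) ^ 2 ≤ wL2sq ν μ := by
  have hi := hμ.1 i
  have hi1 : μ i ≤ 1 :=
    (Finset.single_le_sum (fun j _ => (hμ.1 j).le) (Finset.mem_univ i)).trans hμ.2.le
  have hsingle : (ν i / μ i - 1) ^ 2 * μ i ≤ wL2sq ν μ :=
    Finset.single_le_sum (f := fun i => (ν i / μ i - 1) ^ 2 * μ i)
      (fun j _ => mul_nonneg (sq_nonneg _) (hμ.1 j).le) (Finset.mem_univ i)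
  refine le_trans ?_ hsingle
  have heq : (ν i - μ i) ^ 2 = (ν i / μ i - 1) ^ 2 * μ i * μ i := by field_simp
  rw [heq]
  exact mul_le_of_le_one_right (mul_nonneg (sq_nonneg _) hi.le) hi1

theorem tendsto_of_wL2sq_le_mul_exp {N : ℕ} {μ : Fin N → ℝ} (hμ : IsProbDist μ)
    {ρ : ℝ → Fin N → ℝ} {A C : ℝ} (hC : 0 < C)
    (h : ∀ t, 0 ≤ t → wL2sq (ρ t) μ ≤ A * Real.exp (-C * t)) :
    Filter.Tendsto ρ Filter.atTop (nhds μ) := by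
  have hexp : Filter.Tendsto (fun t => A * Real.exp (-C * t)) Filter.atTop (nhds 0) := by
    have h1 := (Real.tendsto_exp_atBot.comp
      (Filter.tendsto_id.const_mul_atTop_of_neg (neg_lt_zero.2 hC))).const_mul A
    simpa using h1
  rw [tendsto_pi_nhds]
  intro i
  have hsq : Filter.Tendsto (fun t => (ρ t i - μ i) ^ 2) Filter.atTop (nhds 0) :=
    squeeze_zero' (Filter.Eventually.of_forall fun t => sq_nonneg _)
      ((Filter.eventually_ge_atTop 0).mono fun t ht => (sq_sub_le_wL2sq hμ (ρ t) i).trans (h t ht))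
      hexp
  have habs := (Real.continuous_sqrt.tendsto 0).comp hsq
  simp only [Function.comp_def, Real.sqrt_sq_eq_abs, Real.sqrt_zero] at habs
  exact tendsto_sub_nhds_zero_iff.1 ((tendsto_zero_iff_abs_tendsto_zero _).2 habs)

theorem fpe1_exponential_convergence {N : ℕ} (hN : 2 ≤ N)
    (G : SimpleGraph (Fin N)) [DecidableRel G.Adj] (hG : G.Connected)
    (Ψ : Fin N → ℝ) (β : ℝ) (hβ : 0 < β)
    (ρ : ℝ → Fin N → ℝ) (ρ0 : Fin N → ℝ) (hρ0 : IsProbDist ρ0)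
    (hsol : IsFPE1Sol G Ψ β ρ) (hinit : ρ 0 = ρ0) :
    ∃ C > (0:ℝ),
      (∀ t, 0 ≤ t →
        wL2sq (ρ t) (gibbs Ψ β) ≤ wL2sq ρ0 (gibbs Ψ β) * Real.exp (-C * t)) ∧
      Filter.Tendsto ρ Filter.atTop (nhds (gibbs Ψ β)) := by
  have hμ := isProbDist_gibbs hN Ψ β
  have : Nonempty (Fin N) := ⟨⟨0, by omega⟩⟩
  obtain ⟨i₁, hi₁⟩ := Finite.exists_min (gibbs Ψ β)
  obtain ⟨i₀, hi₀⟩ := Finite.exists_min fun i => ρ0 i / gibbs Ψ β i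
  obtain ⟨K, hK, hpoincare⟩ := exists_wL2sq_le_mul_dirichletForm hN hG hμ
  set δ := gibbs Ψ β i₁
  set m := ρ0 i₀ / gibbs Ψ β i₀
  have hδ0 : 0 < δ := gibbs_pos Ψ β i₁
  have hm0 : 0 < m := div_pos (hρ0.1 i₀) (gibbs_pos Ψ β i₀)
  have hlower : ∀ t, 0 ≤ t → ∀ i, m ≤ ρ t i / gibbs Ψ β i := fun t ht i =>
    hsol.le_div_gibbs hβ (by rw [hinit]; exact hi₀) ht i
  have hupper : ∀ t, 0 ≤ t → ∀ i, ρ t i / gibbs Ψ β i ≤ 1 / δ := fun t ht i =>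
    div_le_div₀ zero_le_one ((Finset.single_le_sum (fun j _ => ((hsol.1 t ht).1 j).le)
      (Finset.mem_univ i)).trans (hsol.1 t ht).2.le) hδ0 (hi₁ i)
  set c := β * (m * δ) / (1 / δ) with hc
  have hc0 : 0 < c := by positivity
  have hφ : ∀ x : ℝ, HasDerivAt (fun y => (y - 1) ^ 2) (2 * (x - 1)) x := fun x => by
    simpa using ((hasDerivAt_id x).sub_const 1).fun_pow 2
  have hdecay : ∀ t, 0 ≤ t →
      wL2sq (ρ t) (gibbs Ψ β) ≤ wL2sq ρ0 (gibbs Ψ β) * Real.exp (-(c / K) * t) := by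
    intro t ht
    rw [← hinit]
    refine le_mul_exp_of_hasDerivWithinAt_le (f := fun s => wL2sq (ρ s) (gibbs Ψ β))
      (fun s hs => hsol.hasDerivWithinAt_sum hφ hs) (fun s hs => ?_) ht
    have hdiss : 2 * c * dirichletForm G (fun i => ρ s i / gibbs Ψ β i) ≤
        ∑ i, ∑ j, if G.Adj i j then (2 * (ρ s j / gibbs Ψ β j - 1) -
          2 * (ρ s i / gibbs Ψ β i - 1)) * fpe1Flux Ψ β (ρ s) i j else 0 := by
      rw [dirichletForm, Finset.mul_sum]
      refine Finset.sum_le_sum fun i _ => ?_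
      rw [Finset.mul_sum]
      refine Finset.sum_le_sum fun j _ => ?_
      split_ifs
      · obtain ⟨k, hk, hflux⟩ := exists_fpe1Flux_eq_mul_sub Ψ hβ (ρ s) i j hm0 hδ0 (hi₁ i) (hi₁ j)
          (hlower s hs i) (hlower s hs j) (hupper s hs i) (hupper s hs j)
        rw [hflux]
        nlinarith [mul_le_mul_of_nonneg_right hk
          (sq_nonneg (ρ s j / gibbs Ψ β j - ρ s i / gibbs Ψ β i))]
      · simp
    have hP : c / K * wL2sq (ρ s) (gibbs Ψ β) ≤
        c * dirichletForm G fun i => ρ s i / gibbs Ψ β i := by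
      calc c / K * wL2sq (ρ s) (gibbs Ψ β)
          ≤ c / K * (K * dirichletForm G fun i => ρ s i / gibbs Ψ β i) :=
            mul_le_mul_of_nonneg_left (hpoincare _ (hsol.1 s hs).2) (by positivity)
        _ = _ := by field_simp
    linarith
  exact ⟨c / K, by positivity, hdecay, tendsto_of_wL2sq_le_mul_exp hμ (by positivity) hdecay⟩
end

section
/- Let G = (V,E) be a connected simple graph on N ≥ 2 vertices and ρ* ∈ M a positive probability distribution on V. Let λ₂ be the spectral gap of G and M(ρ*) = max_i ρ*_i. Then for every vector η = (η_1,...,η_N) ∈ ℝ^N with Σ_{i=1}^N ρ*_i η_i = 0, one has Σ_{{a_i,a_j}∈E} (η_j − η_i)² ≥ (λ₂ / (2 M(ρ*))) · Σ_{i=1}^N ρ*_i η_i². -/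
/-!
STATEMENT 3: Poincaré-type inequality on a connected graph: for any vector η
with Σ ρ*_i η_i = 0,
  Σ_{{a_i,a_j}∈E} (η_j − η_i)² ≥ (λ₂ / (2 max_i ρ*_i)) Σ_i ρ*_i η_i².
-/

open Finset Real

/-- The eigenvalues of a real symmetric matrix, sorted in nondecreasing order
(with multiplicity).  For a non-Hermitian matrix this returns the junk value `0`. -/
noncomputable def sortedEigs {N : ℕ} (A : Matrix (Fin N) (Fin N) ℝ) : Fin N → ℝ :=
  if h : A.IsHermitian then h.eigenvalues ∘ Tuple.sort h.eigenvalues else 0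

theorem SimpleGraph.sum_sum_adj_eq_two_mul_sum_edgeFinset {V : Type*} [Fintype V]
    (G : SimpleGraph V) [DecidableRel G.Adj] [Fintype G.edgeSet] (f : Sym2 V → ℝ) :
    ∑ i, ∑ j, (if G.Adj i j then f s(i, j) else 0) = 2 * ∑ e ∈ G.edgeFinset, f e := by
  classical
  have hpairs : ∑ i, ∑ j, (if G.Adj i j then f s(i, j) else 0) = ∑ d : G.Dart, f d.edge := by
    rw [← Finset.sum_product', ← Finset.sum_filter]
    symm
    refine Finset.sum_bij' (fun d _ ↦ (d.fst, d.snd))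
      (fun p hp ↦ ⟨p, (Finset.mem_filter.1 hp).2⟩) ?_ ?_ ?_ ?_ ?_ <;> simp
    exact fun d ↦ rfl
  rw [hpairs, ← Finset.sum_fiberwise_of_maps_to (t := G.edgeFinset) (g := SimpleGraph.Dart.edge)
    (fun d _ ↦ SimpleGraph.mem_edgeFinset.2 d.edge_mem), Finset.mul_sum]
  refine Finset.sum_congr rfl fun e he ↦ ?_
  rw [Finset.sum_congr rfl (g := fun _ ↦ f e)
      (fun d hd ↦ by rw [(Finset.mem_filter.1 hd).2]),
    Finset.sum_const, G.dart_edge_fiber_card e (SimpleGraph.mem_edgeFinset.1 he)]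
  simp

namespace Matrix.IsHermitian

open Matrix

theorem dotProduct_mulVec_comm {n : Type*} [Fintype n] {A : Matrix n n ℝ} (hA : A.IsHermitian)
    (x y : n → ℝ) : x ⬝ᵥ A *ᵥ y = A *ᵥ x ⬝ᵥ y := by
  have hT : Aᵀ = A := by simpa [IsHermitian] using hA
  rw [dotProduct_mulVec, ← mulVec_transpose, hT]

variable {n : Type*} [Fintype n] [DecidableEq n] {A : Matrix n n ℝ} (hA : A.IsHermitian)

theorem eigenvectorBasis_dotProduct_mulVec (x : n → ℝ) (i : n) :
    ⇑(hA.eigenvectorBasis i) ⬝ᵥ A *ᵥ x =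
      hA.eigenvalues i * (⇑(hA.eigenvectorBasis i) ⬝ᵥ x) := by
  rw [hA.dotProduct_mulVec_comm, hA.mulVec_eigenvectorBasis, smul_dotProduct, smul_eq_mul]

theorem sum_eigenvectorBasis_dotProduct_mul (x y : n → ℝ) :
    ∑ i, (⇑(hA.eigenvectorBasis i) ⬝ᵥ x) * (⇑(hA.eigenvectorBasis i) ⬝ᵥ y) = x ⬝ᵥ y := by
  have h := hA.eigenvectorBasis.sum_inner_mul_inner (WithLp.toLp 2 x) (WithLp.toLp 2 y)
  simpa [EuclideanSpace.inner_eq_star_dotProduct, dotProduct_comm] using h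

end Matrix.IsHermitian

open Matrix in
/-- The second smallest eigenvalue of a positive semidefinite matrix bounds its quadratic form from
below on the orthogonal complement of any nonzero kernel vector. -/
theorem Matrix.PosSemidef.sortedEigs_one_mul_dotProduct_le {N : ℕ} (hN : 1 < N)
    {A : Matrix (Fin N) (Fin N) ℝ} (hA : A.PosSemidef) {x v : Fin N → ℝ} (hx : x ≠ 0)
    (hAx : A *ᵥ x = 0) (hv : x ⬝ᵥ v = 0) :
    sortedEigs A ⟨1, hN⟩ * (v ⬝ᵥ v) ≤ v ⬝ᵥ A *ᵥ v := by
  have hH := hA.isHermitian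
  set σ := Tuple.sort hH.eigenvalues
  set i₀ := σ ⟨0, by lia⟩
  have hsorted : sortedEigs A = hH.eigenvalues ∘ σ := dif_pos hH
  have hmono : Monotone (hH.eigenvalues ∘ σ) := Tuple.monotone_sort _
  rw [hsorted]
  set μ := (hH.eigenvalues ∘ σ) ⟨1, hN⟩
  have hnonneg : 0 ≤ v ⬝ᵥ A *ᵥ v := by simpa using hA.dotProduct_mulVec_nonneg v
  have hvv : 0 ≤ v ⬝ᵥ v := by simpa using dotProduct_star_self_nonneg v
  rcases le_or_gt μ 0 with hμ0 | hμ0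
  · exact (mul_nonpos_of_nonpos_of_nonneg hμ0 hvv).trans hnonneg
  have hle : ∀ i, i ≠ i₀ → μ ≤ hH.eigenvalues i := by
    intro i hi
    obtain ⟨k, rfl⟩ := σ.surjective i
    refine hmono (Fin.le_def.2 (Nat.one_le_iff_ne_zero.2 fun hk ↦ hi ?_))
    exact congrArg σ (Fin.ext hk)
  have hxi : ∀ i, i ≠ i₀ → ⇑(hH.eigenvectorBasis i) ⬝ᵥ x = 0 := by
    intro i hi
    have h := hH.eigenvectorBasis_dotProduct_mulVec x i
    rw [hAx, dotProduct_zero] at h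
    exact (mul_eq_zero.1 h.symm).resolve_left (hμ0.trans_le (hle i hi)).ne'
  have hparseval (y : Fin N → ℝ) :
      (⇑(hH.eigenvectorBasis i₀) ⬝ᵥ x) *
        (⇑(hH.eigenvectorBasis i₀) ⬝ᵥ y) = x ⬝ᵥ y := by
    rw [← hH.sum_eigenvectorBasis_dotProduct_mul x y]
    symm
    exact Finset.sum_eq_single_of_mem _ (Finset.mem_univ _)
      fun i _ hi ↦ by rw [hxi i hi, zero_mul]
  have hv0 : ⇑(hH.eigenvectorBasis i₀) ⬝ᵥ v = 0 := by
    refine (mul_eq_zero.1 ((hparseval v).trans hv)).resolve_left fun h ↦ hx ?_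
    rw [← dotProduct_self_eq_zero, ← hparseval x, h, zero_mul]
  rw [← hH.sum_eigenvectorBasis_dotProduct_mul v v,
    ← hH.sum_eigenvectorBasis_dotProduct_mul v (A *ᵥ v), Finset.mul_sum]
  refine Finset.sum_le_sum fun i _ ↦ ?_
  rw [hH.eigenvectorBasis_dotProduct_mulVec]
  by_cases hi : i = i₀
  · rw [hi, hv0]; simp
  · nlinarith [mul_le_mul_of_nonneg_right (hle i hi)
      (mul_self_nonneg (⇑(hH.eigenvectorBasis i) ⬝ᵥ v))]

/-- The mean minimizes the second moment `c ↦ ∑ i, ρ i * (η i - c) ^ 2`. -/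
theorem IsProbDist.sum_mul_sq_le_sum_mul_sub_sq {N : ℕ} {ρ : Fin N → ℝ} (hρ : IsProbDist ρ)
    {η : Fin N → ℝ} (hη : ∑ i, ρ i * η i = 0) (c : ℝ) :
    ∑ i, ρ i * η i ^ 2 ≤ ∑ i, ρ i * (η i - c) ^ 2 := by
  have h : ∑ i, ρ i * (η i - c) ^ 2 =
      ∑ i, ρ i * η i ^ 2 - 2 * c * ∑ i, ρ i * η i + c ^ 2 * ∑ i, ρ i := by
    rw [Finset.mul_sum, Finset.mul_sum, ← Finset.sum_sub_distrib, ← Finset.sum_add_distrib]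
    exact Finset.sum_congr rfl fun i _ ↦ by ring
  rw [h, hη, hρ.2]
  nlinarith [sq_nonneg c]

open Matrix in
theorem SimpleGraph.sortedEigs_lapMatrix_one_mul_sum_sub_mean_sq_le {N : ℕ} (hN : 1 < N)
    (G : SimpleGraph (Fin N)) [DecidableRel G.Adj] (η : Fin N → ℝ) :
    sortedEigs (G.lapMatrix ℝ) ⟨1, hN⟩ * ∑ i, (η i - (∑ j, η j) / N) ^ 2 ≤
      ∑ e ∈ G.edgeFinset,
        Sym2.lift ⟨fun i j => (η j - η i) ^ 2, fun a b => by ring⟩ e := by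
  have hN0 : (N : ℝ) ≠ 0 := by positivity
  set v : Fin N → ℝ := fun i ↦ η i - (∑ j, η j) / N with hvdef
  have hx : (fun _ ↦ 1 : Fin N → ℝ) ≠ 0 := fun h ↦ one_ne_zero (congrFun h ⟨0, by lia⟩)
  have hv : (fun _ ↦ 1) ⬝ᵥ v = 0 := by
    simp only [dotProduct, one_mul, hvdef, Finset.sum_sub_distrib, Finset.sum_const,
      Finset.card_univ, Fintype.card_fin, nsmul_eq_mul]
    rw [mul_div_cancel₀ _ hN0, sub_self]
  have hgap := (G.posSemidef_lapMatrix ℝ).sortedEigs_one_mul_dotProduct_le hN hx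
    G.lapMatrix_mulVec_const_eq_zero hv
  rw [← toLinearMap₂'_apply', SimpleGraph.lapMatrix_toLinearMap₂'] at hgap
  have hedge := G.sum_sum_adj_eq_two_mul_sum_edgeFinset
    (Sym2.lift ⟨fun i j => (η j - η i) ^ 2, fun a b => by ring⟩)
  simp only [Sym2.lift_mk] at hedge
  have hdiff : ∀ i j, (v i - v j) ^ 2 = (η j - η i) ^ 2 := fun i j ↦ by
    simp only [hvdef]; ring
  simp only [hdiff, hedge, dotProduct, ← pow_two] at hgap
  linarith

theorem graph_poincare_inequality {N : ℕ} (hN : 2 ≤ N)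
    (G : SimpleGraph (Fin N)) [DecidableRel G.Adj] (hG : G.Connected)
    (ρs : Fin N → ℝ) (hρs : IsProbDist ρs)
    (η : Fin N → ℝ) (hη : ∑ i, ρs i * η i = 0) :
    (sortedEigs (G.lapMatrix ℝ) ⟨1, by omega⟩ / (2 * ⨆ i, ρs i)) *
        ∑ i, ρs i * η i ^ 2 ≤
      ∑ e ∈ G.edgeFinset,
        Sym2.lift ⟨fun i j => (η j - η i) ^ 2, fun a b => by ring⟩ e := by
  set M := ⨆ i, ρs i
  have hle : ∀ i, ρs i ≤ M := fun i ↦ le_ciSup (Set.finite_range ρs).bddAbove i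
  have hM : 0 < M := (hρs.1 ⟨0, by lia⟩).trans_le (hle _)
  set E := ∑ e ∈ G.edgeFinset,
    Sym2.lift ⟨fun i j => (η j - η i) ^ 2, fun a b => by ring⟩ e
  have hE : 0 ≤ E := Finset.sum_nonneg fun e _ ↦ by
    induction e with
    | _ i j => exact sq_nonneg _
  have hgap := G.sortedEigs_lapMatrix_one_mul_sum_sub_mean_sq_le (by lia) η
  set lam := sortedEigs (G.lapMatrix ℝ) ⟨1, by lia⟩
  have hmoment : ∑ i, ρs i * η i ^ 2 ≤ M * ∑ i, (η i - (∑ j, η j) / N) ^ 2 := by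
    refine (hρs.sum_mul_sq_le_sum_mul_sub_sq hη ((∑ j, η j) / N)).trans ?_
    rw [Finset.mul_sum]
    exact Finset.sum_le_sum fun i _ ↦ mul_le_mul_of_nonneg_right (hle i) (sq_nonneg _)
  have hS : 0 ≤ ∑ i, ρs i * η i ^ 2 :=
    Finset.sum_nonneg fun i _ ↦ mul_nonneg (hρs.1 i).le (sq_nonneg _)
  rw [div_mul_eq_mul_div, div_le_iff₀ (by positivity)]
  rcases le_total lam 0 with hlam | hlam
  · exact (mul_nonpos_of_nonpos_of_nonneg hlam hS).trans (by positivity)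
  · nlinarith [mul_le_mul_of_nonneg_left hmoment hlam, mul_le_mul_of_nonneg_left hgap hM.le,
      mul_nonneg hE hM.le]
end

section
/- Let G = (V,E) be a connected simple graph on N ≥ 2 vertices. For every μ ∈ M and every compact subset B of M (with respect to the Euclidean metric), there exist a potential function Ψ = (Ψ_i)_{i=1}^N on V and a constant K > 0 (depending on B, μ and G) such that for all ν ∈ B: d_Ψ²(μ, ν) ≤ K · H(ν|μ). -/
/-!
STATEMENT 5: Local Talagrand-type inequality for the metric d_Ψ:
for each μ ∈ M and each compact B ⊆ M there are a potential Ψ and K > 0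
with d_Ψ²(μ,ν) ≤ K H(ν|μ) for all ν ∈ B.
-/

open Finset Real Matrix Classical

/-- Relative entropy `H(ν|μ) = Σ_i ν_i log (ν_i/μ_i)`. -/
noncomputable def relEnt {N : ℕ} (ν μ : Fin N → ℝ) : ℝ :=
  ∑ i, ν i * Real.log (ν i / μ i)

/-- Weighted Laplacian `L(G,w) = diag(row sums) − w` (the graph structure is
encoded in the vanishing pattern of `w`). -/
noncomputable def wLap {N : ℕ} (w : Matrix (Fin N) (Fin N) ℝ) :
    Matrix (Fin N) (Fin N) ℝ :=
  Matrix.diagonal (fun i => ∑ j, w i j) - w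

/-- The quadratic form `g(σ,σ) = p L pᵀ`, where `p` is a row vector with
`σ = p L`; since `p L pᵀ = p ⬝ᵥ σ` this value does not depend on the choice
of `p` when `σ` is in the range of `L` and sums to zero. -/
noncomputable def quadForm {N : ℕ} (L : Matrix (Fin N) (Fin N) ℝ)
    (σ : Fin N → ℝ) : ℝ :=
  if h : ∃ p, Matrix.vecMul p L = σ then Classical.choose h ⬝ᵥ σ else 0

/-- The weight matrix `w(ρ)` associated with the potential `Ψ`. -/
noncomputable def weightPsi {N : ℕ} (G : SimpleGraph (Fin N)) [DecidableRel G.Adj]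
    (Ψ : Fin N → ℝ) (ρ : Fin N → ℝ) : Matrix (Fin N) (Fin N) ℝ :=
  Matrix.of fun i j =>
    if G.Adj i j then
      if Ψ j < Ψ i then ρ i
      else if Ψ i < Ψ j then ρ j
      else if ρ i = ρ j then ρ i
      else (ρ i - ρ j) / (Real.log (ρ i) - Real.log (ρ j))
    else 0

/-- The set of arc lengths of C¹ curves in `M` joining `ρ1` to `ρ2`, for the
Riemannian structure with weight matrix `gmat ρ` at `ρ`. -/
noncomputable def arcLengthSet {N : ℕ}
    (gmat : (Fin N → ℝ) → Matrix (Fin N) (Fin N) ℝ)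
    (ρ1 ρ2 : Fin N → ℝ) : Set ℝ :=
  { l | ∃ γ : ℝ → Fin N → ℝ, ContDiffOn ℝ 1 γ (Set.Icc 0 1) ∧
      (∀ t ∈ Set.Icc (0 : ℝ) 1, IsProbDist (γ t)) ∧ γ 0 = ρ1 ∧ γ 1 = ρ2 ∧
      l = ∫ t in (0 : ℝ)..1,
            Real.sqrt (quadForm (wLap (gmat (γ t))) (deriv γ t)) }

/-- The Riemannian distance `d_Ψ` on `M` associated with the potential `Ψ`. -/
noncomputable def dPsi {N : ℕ} (G : SimpleGraph (Fin N)) [DecidableRel G.Adj]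
    (Ψ : Fin N → ℝ) (ρ1 ρ2 : Fin N → ℝ) : ℝ :=
  sInf (arcLengthSet (weightPsi G Ψ) ρ1 ρ2)

theorem sq_sub_le_four_mul_entropy {x y : ℝ} (hx : 0 < x) (hy : 0 < y) (hx1 : x ≤ 1)
    (hy1 : y ≤ 1) : (x - y) ^ 2 ≤ 4 * (x * Real.log (x / y) - x + y) := by
  obtain ⟨a, ha, rfl⟩ : ∃ a, 0 < a ∧ a ^ 2 = x := ⟨√x, Real.sqrt_pos.2 hx, Real.sq_sqrt hx.le⟩
  obtain ⟨b, hb, rfl⟩ : ∃ b, 0 < b ∧ b ^ 2 = y := ⟨√y, Real.sqrt_pos.2 hy, Real.sq_sqrt hy.le⟩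
  have ha1 : a ≤ 1 := by nlinarith
  have hb1 : b ≤ 1 := by nlinarith
  have hlog : Real.log (a ^ 2 / b ^ 2) = -(2 * Real.log (b / a)) := by
    rw [← div_pow, Real.log_pow, Real.log_div ha.ne' hb.ne', Real.log_div hb.ne' ha.ne']
    push_cast
    ring
  have hle : a ^ 2 * Real.log (b / a) ≤ a ^ 2 * (b / a - 1) :=
    mul_le_mul_of_nonneg_left (Real.log_le_sub_one_of_pos (by positivity)) (by positivity)
  have heq : a ^ 2 * (b / a - 1) = a * b - a ^ 2 := by field_simp
  have hsum : (a + b) ^ 2 ≤ 4 := by nlinarith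
  have hmul := mul_le_mul_of_nonneg_right hsum (sq_nonneg (a - b))
  rw [hlog]
  nlinarith

theorem IsProbDist.le_one {N : ℕ} {ρ : Fin N → ℝ} (hρ : IsProbDist ρ) (i : Fin N) : ρ i ≤ 1 :=
  hρ.2 ▸ Finset.single_le_sum (fun j _ => (hρ.1 j).le) (Finset.mem_univ i)

theorem sum_sq_sub_le_four_mul_relEnt {N : ℕ} {ν μ : Fin N → ℝ} (hν : IsProbDist ν)
    (hμ : IsProbDist μ) : ∑ i, (ν i - μ i) ^ 2 ≤ 4 * relEnt ν μ := by
  calc ∑ i, (ν i - μ i) ^ 2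
      ≤ ∑ i, 4 * (ν i * Real.log (ν i / μ i) - ν i + μ i) := Finset.sum_le_sum fun i _ =>
        sq_sub_le_four_mul_entropy (hν.1 i) (hμ.1 i) (hν.le_one i) (hμ.le_one i)
    _ = 4 * relEnt ν μ := by
        rw [← Finset.mul_sum, Finset.sum_add_distrib, Finset.sum_sub_distrib, hν.2, hμ.2, relEnt]
        ring

theorem vecMul_wLap_apply {N : ℕ} {w : Matrix (Fin N) (Fin N) ℝ} (hw : ∀ i j, w i j = w j i)
    (p : Fin N → ℝ) (i : Fin N) :
    Matrix.vecMul p (wLap w) i = ∑ j, w i j * (p i - p j) := by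
  rw [wLap, Matrix.vecMul_sub, Pi.sub_apply, Matrix.vecMul_diagonal, Finset.mul_sum,
    Matrix.vecMul, dotProduct, ← Finset.sum_sub_distrib]
  refine Finset.sum_congr rfl fun j _ => ?_
  rw [hw j i]
  ring

theorem two_mul_dotProduct_vecMul_wLap {N : ℕ} {w : Matrix (Fin N) (Fin N) ℝ}
    (hw : ∀ i j, w i j = w j i) (p : Fin N → ℝ) :
    2 * (p ⬝ᵥ Matrix.vecMul p (wLap w)) = ∑ i, ∑ j, w i j * (p i - p j) ^ 2 := by
  have h1 : p ⬝ᵥ Matrix.vecMul p (wLap w) = ∑ i, ∑ j, p i * (w i j * (p i - p j)) := by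
    simp only [dotProduct, vecMul_wLap_apply hw, Finset.mul_sum]
  have h2 : p ⬝ᵥ Matrix.vecMul p (wLap w) = ∑ i, ∑ j, p j * (w i j * (p j - p i)) := by
    rw [h1, Finset.sum_comm]
    exact Finset.sum_congr rfl fun i _ => Finset.sum_congr rfl fun j _ => by rw [hw j i]
  rw [two_mul]
  nth_rewrite 1 [h1]
  rw [h2]
  simp only [← Finset.sum_add_distrib]
  exact Finset.sum_congr rfl fun i _ => Finset.sum_congr rfl fun j _ => by ring

theorem mul_sq_sub_le_dotProduct_vecMul_wLap {N : ℕ} {w : Matrix (Fin N) (Fin N) ℝ}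
    (hw : ∀ i j, w i j = w j i) (hw0 : ∀ i j, 0 ≤ w i j) (p : Fin N → ℝ) {i j : Fin N}
    (hij : i ≠ j) : w i j * (p i - p j) ^ 2 ≤ p ⬝ᵥ Matrix.vecMul p (wLap w) := by
  have hnn : ∀ a b, 0 ≤ w a b * (p a - p b) ^ 2 := fun a b => mul_nonneg (hw0 a b) (sq_nonneg _)
  have hrow : ∀ a b, w a b * (p a - p b) ^ 2 ≤ ∑ c, w a c * (p a - p c) ^ 2 := fun a b =>
    Finset.single_le_sum (f := fun c => w a c * (p a - p c) ^ 2) (fun c _ => hnn a c)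
      (Finset.mem_univ b)
  have hpair := Finset.sum_le_univ_sum_of_nonneg (s := {i, j})
    (f := fun a => ∑ c, w a c * (p a - p c) ^ 2) fun a => Finset.sum_nonneg fun c _ => hnn a c
  rw [Finset.sum_pair hij, ← two_mul_dotProduct_vecMul_wLap hw] at hpair
  have h1 := hrow i j
  have h2 := hrow j i
  rw [hw j i] at h2
  nlinarith

theorem SimpleGraph.Walk.abs_sub_le_length_mul {V : Type*} {G : SimpleGraph V} {p : V → ℝ} {r : ℝ}
    (hr : ∀ i j, G.Adj i j → |p i - p j| ≤ r) {i j : V} (W : G.Walk i j) :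
    |p i - p j| ≤ W.length * r := by
  induction W with
  | nil => simp
  | @cons u v x h q ih =>
    have := abs_sub_le (p u) (p v) (p x)
    have := hr _ _ h
    rw [SimpleGraph.Walk.length_cons]
    push_cast
    linarith

theorem SimpleGraph.Connected.abs_sub_le_card_mul {V : Type*} [Fintype V] {G : SimpleGraph V}
    (hG : G.Connected) {p : V → ℝ} {r : ℝ} (hr0 : 0 ≤ r)
    (hr : ∀ i j, G.Adj i j → |p i - p j| ≤ r) (i j : V) :
    |p i - p j| ≤ Fintype.card V * r := by
  obtain ⟨W, hW⟩ := hG.exists_isPath i j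
  refine (W.abs_sub_le_length_mul hr).trans (mul_le_mul_of_nonneg_right ?_ hr0)
  exact_mod_cast hW.length_lt.le

theorem sqrt_quadForm_wLap_le {N : ℕ} {G : SimpleGraph (Fin N)} (hG : G.Connected)
    {w : Matrix (Fin N) (Fin N) ℝ} (hw : ∀ i j, w i j = w j i) (hw0 : ∀ i j, 0 ≤ w i j)
    {δ : ℝ} (hδ : 0 < δ) (hwδ : ∀ i j, G.Adj i j → δ ≤ w i j)
    {σ : Fin N → ℝ} (hσ : ∑ i, σ i = 0) :
    √(quadForm (wLap w) σ) ≤ N / √δ * ∑ i, |σ i| := by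
  have hrhs : 0 ≤ N / √δ * ∑ i, |σ i| := by positivity
  unfold quadForm
  split_ifs with h
  swap
  · simpa using hrhs
  have hp := Classical.choose_spec h
  generalize Classical.choose h = p at hp ⊢
  rcases (Real.sqrt_nonneg (p ⬝ᵥ σ)).eq_or_lt with hs | hs
  · rwa [← hs]
  have hq : 0 < p ⬝ᵥ σ := Real.sqrt_pos.1 hs
  have hedge : ∀ i j, G.Adj i j → |p i - p j| ≤ √(p ⬝ᵥ σ) / √δ := by
    intro i j hij
    rw [← Real.sqrt_div hq.le]
    refine Real.abs_le_sqrt ((le_div_iff₀ hδ).2 ?_)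
    calc (p i - p j) ^ 2 * δ ≤ w i j * (p i - p j) ^ 2 := by
          rw [mul_comm]
          exact mul_le_mul_of_nonneg_right (hwδ i j hij) (sq_nonneg _)
      _ ≤ p ⬝ᵥ σ := hp ▸ mul_sq_sub_le_dotProduct_vecMul_wLap hw hw0 p hij.ne
  obtain ⟨i₀⟩ := hG.nonempty
  have hosc := hG.abs_sub_le_card_mul (by positivity) hedge
  have hbound : p ⬝ᵥ σ ≤ N * (√(p ⬝ᵥ σ) / √δ) * ∑ i, |σ i| := by
    calc p ⬝ᵥ σ = ∑ i, (p i - p i₀) * σ i := by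
          simp only [sub_mul, Finset.sum_sub_distrib, ← Finset.mul_sum, hσ, dotProduct]
          ring
      _ ≤ ∑ i, N * (√(p ⬝ᵥ σ) / √δ) * |σ i| := Finset.sum_le_sum fun i _ => by
          refine (le_abs_self _).trans ?_
          rw [abs_mul]
          exact mul_le_mul_of_nonneg_right (by simpa using hosc i i₀) (abs_nonneg _)
      _ = _ := by rw [← Finset.mul_sum]
  refine le_of_mul_le_mul_left ?_ hs
  calc √(p ⬝ᵥ σ) * √(p ⬝ᵥ σ) = p ⬝ᵥ σ := Real.mul_self_sqrt hq.le
    _ ≤ _ := hbound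
    _ = _ := by ring

theorem weightPsi_of_injective {N : ℕ} (G : SimpleGraph (Fin N)) [DecidableRel G.Adj]
    {Ψ : Fin N → ℝ} (hΨ : Function.Injective Ψ) (ρ : Fin N → ℝ) (i j : Fin N) :
    weightPsi G Ψ ρ i j = if G.Adj i j then (if Ψ j < Ψ i then ρ i else ρ j) else 0 := by
  unfold weightPsi
  rw [Matrix.of_apply]
  split_ifs with h h1 h2 <;> first | rfl | skip
  all_goals exact absurd (hΨ (le_antisymm (not_lt.1 h1) (not_lt.1 h2))) h.ne

theorem dPsi_sq_le_of_injective {N : ℕ} {G : SimpleGraph (Fin N)} [DecidableRel G.Adj]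
    (hG : G.Connected) {Ψ : Fin N → ℝ} (hΨ : Function.Injective Ψ) {μ ν : Fin N → ℝ}
    (hμ : IsProbDist μ) (hν : IsProbDist ν) {δ : ℝ} (hδ : 0 < δ) (hμδ : ∀ i, δ ≤ μ i)
    (hνδ : ∀ i, δ ≤ ν i) :
    dPsi G Ψ μ ν ^ 2 ≤ 4 * N ^ 3 / δ * relEnt ν μ := by
  set γ : ℝ → Fin N → ℝ := fun t => μ + t • (ν - μ) with hγ
  have hderiv : ∀ t, deriv γ t = ν - μ := fun t => by
    have h : HasDerivAt γ ((1 : ℝ) • (ν - μ)) t :=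
      ((hasDerivAt_id t).smul_const (ν - μ)).const_add μ
    simpa using h.deriv
  have hsum : ∑ i, (ν - μ) i = 0 := by
    simp [Finset.sum_sub_distrib, hν.2, hμ.2]
  have hlow : ∀ t ∈ Set.Icc (0 : ℝ) 1, ∀ i, δ ≤ γ t i := by
    rintro t ⟨h0, h1⟩ i
    simp only [hγ, Pi.add_apply, Pi.smul_apply, Pi.sub_apply, smul_eq_mul]
    nlinarith [hμδ i, hνδ i]
  have hprob : ∀ t ∈ Set.Icc (0 : ℝ) 1, IsProbDist (γ t) := fun t ht => by
    refine ⟨fun i => hδ.trans_le (hlow t ht i), ?_⟩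
    simp only [hγ, Pi.add_apply, Pi.smul_apply, smul_eq_mul, Finset.sum_add_distrib,
      ← Finset.mul_sum, hsum, hμ.2]
    ring
  have hspeed : ∀ t ∈ Set.Icc (0 : ℝ) 1,
      √(quadForm (wLap (weightPsi G Ψ (γ t))) (deriv γ t)) ≤ N / √δ * ∑ i, |(ν - μ) i| := by
    intro t ht
    rw [hderiv]
    refine sqrt_quadForm_wLap_le hG (fun i j => ?_) (fun i j => ?_) hδ (fun i j hij => ?_) hsum
    · simp only [weightPsi_of_injective G hΨ, G.adj_comm j i]
      split_ifs with h h1 h2 h3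
      · exact absurd h1 h2.asymm
      · rfl
      · rfl
      · exact absurd (hΨ (le_antisymm (not_lt.1 h1) (not_lt.1 h3))) h.ne
      · rfl
    · have := (hprob t ht).1
      rw [weightPsi_of_injective G hΨ]
      split_ifs
      exacts [(this i).le, (this j).le, le_rfl]
    · rw [weightPsi_of_injective G hΨ, if_pos hij]
      split_ifs
      exacts [hlow t ht i, hlow t ht j]
  have hnonneg : ∀ l ∈ arcLengthSet (weightPsi G Ψ) μ ν, 0 ≤ l := by
    rintro l ⟨c, -, -, -, -, rfl⟩
    exact intervalIntegral.integral_nonneg zero_le_one fun _ _ => Real.sqrt_nonneg _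
  have hd : dPsi G Ψ μ ν ≤ N / √δ * ∑ i, |(ν - μ) i| := by
    refine (csInf_le ⟨0, hnonneg⟩ ⟨γ, ?_, hprob, ?_, ?_, rfl⟩).trans ?_
    · exact ContDiff.contDiffOn (by fun_prop)
    · simp [hγ]
    · simp [hγ]
    · refine (le_abs_self _).trans ?_
      have := intervalIntegral.norm_integral_le_of_norm_le_const (a := (0 : ℝ)) (b := 1)
        (f := fun t => √(quadForm (wLap (weightPsi G Ψ (γ t))) (deriv γ t)))
        (C := N / √δ * ∑ i, |(ν - μ) i|) fun t ht => by
          rw [Set.uIoc_of_le zero_le_one] at ht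
          rw [Real.norm_of_nonneg (Real.sqrt_nonneg _)]
          exact hspeed t ⟨ht.1.le, ht.2⟩
      simpa using this
  have hl1 : (∑ i, |(ν - μ) i|) ^ 2 ≤ N * ∑ i, (ν i - μ i) ^ 2 := by
    simpa using sq_sum_le_card_mul_sum_sq (s := Finset.univ) (f := fun i => |(ν - μ) i|)
  calc dPsi G Ψ μ ν ^ 2 ≤ (N / √δ * ∑ i, |(ν - μ) i|) ^ 2 :=
        pow_le_pow_left₀ (Real.sInf_nonneg hnonneg) hd 2
    _ = N ^ 2 / δ * (∑ i, |(ν - μ) i|) ^ 2 := by rw [mul_pow, div_pow, Real.sq_sqrt hδ.le]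
    _ ≤ N ^ 2 / δ * (N * (4 * relEnt ν μ)) := by
        gcongr
        exact hl1.trans (by gcongr; exact sum_sq_sub_le_four_mul_relEnt hν hμ)
    _ = _ := by ring

theorem IsCompact.exists_pos_forall_le_apply {ι : Type*} [Finite ι] {B : Set (ι → ℝ)}
    (hB : IsCompact B) (hpos : ∀ ν ∈ B, ∀ i, 0 < ν i) :
    ∃ δ > 0, ∀ ν ∈ B, ∀ i, δ ≤ ν i := by
  have hcoord : ∀ i, ∃ δ > 0, ∀ ν ∈ B, δ ≤ ν i := fun i =>
    hB.exists_forall_le' (continuous_apply i).continuousOn fun ν hν => hpos ν hν i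
  choose δ hδ0 hδ using hcoord
  cases isEmpty_or_nonempty ι
  · exact ⟨1, one_pos, fun _ _ i => isEmptyElim i⟩
  · obtain ⟨i₀, hi₀⟩ := Finite.exists_min δ
    exact ⟨δ i₀, hδ0 i₀, fun ν hν i => (hi₀ i).trans (hδ i ν hν)⟩

theorem local_talagrand_dPsi {N : ℕ} (hN : 2 ≤ N)
    (G : SimpleGraph (Fin N)) [DecidableRel G.Adj] (hG : G.Connected)
    (μ : Fin N → ℝ) (hμ : IsProbDist μ)
    (B : Set (Fin N → ℝ)) (hBcompact : IsCompact B)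
    (hBsub : ∀ ν ∈ B, IsProbDist ν) :
    ∃ (Ψ : Fin N → ℝ) (K : ℝ), 0 < K ∧
      ∀ ν ∈ B, dPsi G Ψ μ ν ^ 2 ≤ K * relEnt ν μ := by
  obtain ⟨δ, hδ, hlow⟩ := (hBcompact.insert μ).exists_pos_forall_le_apply fun ν hν =>
    (Set.forall_mem_insert.2 ⟨hμ, hBsub⟩ ν hν).1
  have hNpos : 0 < N := by omega
  refine ⟨fun i => (i : ℕ), 4 * N ^ 3 / δ, by positivity, fun ν hν => ?_⟩
  exact dPsi_sq_le_of_injective hG (Nat.cast_injective.comp Fin.val_injective) hμ (hBsub ν hν) hδ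
    (hlow μ (Set.mem_insert μ B)) (hlow ν (Set.mem_insert_of_mem μ hν))
end

section
/- Let G = (V,E) be a connected simple graph on N ≥ 2 vertices, Ψ a potential on V, β > 0, and ρ* the Gibbs distribution. Let ρ(t) : [0,∞) → M be a solution of Fokker–Planck equation II, and set f_i(t) = ρ_i(t)/ρ*_i. Then for every t > 0 the relative entropy satisfies the dissipation identity: d/dt H(ρ(t)|ρ*) = −β · Σ_{{a_i,a_j}∈E, f_j(t) < f_i(t)} (log f_i(t) − log f_j(t))² ρ_i(t). -/
/-!
STATEMENT 7: Entropy dissipation identity for Fokker–Planck equation II: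
d/dt H(ρ(t)|ρ*) = −β Σ_{{a_i,a_j}∈E, f_j<f_i} (log f_i − log f_j)² ρ_i(t).
-/

open Finset Real

/-- Right hand side of Fokker–Planck equation II (`Ψ̄_i = Ψ_i + β log ρ_i`). -/
noncomputable def fpe2RHS {N : ℕ} (G : SimpleGraph (Fin N)) [DecidableRel G.Adj]
    (Ψ : Fin N → ℝ) (β : ℝ) (ρ : Fin N → ℝ) (i : Fin N) : ℝ :=
  (∑ j, if G.Adj i j ∧ Ψ i + β * Real.log (ρ i) < Ψ j + β * Real.log (ρ j) then
      ((Ψ j + β * Real.log (ρ j)) - (Ψ i + β * Real.log (ρ i))) * ρ j else 0)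
  + (∑ j, if G.Adj i j ∧ Ψ j + β * Real.log (ρ j) < Ψ i + β * Real.log (ρ i) then
      ((Ψ j + β * Real.log (ρ j)) - (Ψ i + β * Real.log (ρ i))) * ρ i else 0)

/-- `ρ : [0,∞) → M` is a solution of Fokker–Planck equation II. -/
def IsFPE2Sol {N : ℕ} (G : SimpleGraph (Fin N)) [DecidableRel G.Adj]
    (Ψ : Fin N → ℝ) (β : ℝ) (ρ : ℝ → Fin N → ℝ) : Prop :=
  (∀ t, 0 ≤ t → IsProbDist (ρ t)) ∧
  ∀ t, 0 ≤ t → ∀ i,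
    HasDerivWithinAt (fun s => ρ s i) (fpe2RHS G Ψ β (ρ t) i) (Set.Ici 0) t

theorem potential_add_log_eq {N : ℕ} (Ψ : Fin N → ℝ) {β : ℝ} (hβ : β ≠ 0) {x : ℝ} (hx : 0 < x)
    (i : Fin N) :
    Ψ i + β * Real.log x =
      β * Real.log (x / gibbs Ψ β i) - β * Real.log (∑ j, Real.exp (-Ψ j / β)) := by
  have hK : 0 < ∑ j, Real.exp (-Ψ j / β) :=
    Finset.sum_pos (fun j _ => Real.exp_pos _) ⟨i, Finset.mem_univ i⟩
  unfold gibbs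
  rw [Real.log_div hx.ne' (div_pos (Real.exp_pos _) hK).ne',
    Real.log_div (Real.exp_pos _).ne' hK.ne', Real.log_exp]
  field_simp
  ring

/-- Summation by parts for a net flow on a finite set. -/
theorem sum_add_one_mul_sum_sub_swap {ι : Type*} [Fintype ι] (L : ι → ℝ) (F : ι → ι → ℝ) :
    ∑ i, (L i + 1) * ∑ j, (F j i - F i j) = -∑ i, ∑ j, (L i - L j) * F i j := by
  have h : ∑ i, ∑ j, (L i + 1) * F j i = ∑ i, ∑ j, (L j + 1) * F i j := Finset.sum_comm
  simp only [Finset.mul_sum, mul_sub, Finset.sum_sub_distrib, h]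
  simp only [← Finset.sum_sub_distrib, ← Finset.sum_neg_distrib]
  exact Finset.sum_congr rfl fun i _ => Finset.sum_congr rfl fun j _ => by ring

/-- The right hand side of the equation is the net flow along the edges, each edge being oriented
from its endpoint of larger relative density to the other one. -/
theorem fpe2RHS_eq_sum_flow {N : ℕ} (G : SimpleGraph (Fin N)) [DecidableRel G.Adj]
    (Ψ : Fin N → ℝ) {β : ℝ} (hβ : 0 < β) {ρ L : Fin N → ℝ} (hρ : ∀ i, 0 < ρ i)
    (hL : ∀ i, L i = Real.log (ρ i / gibbs Ψ β i)) (i : Fin N) :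
    fpe2RHS G Ψ β ρ i =
      ∑ j, ((if G.Adj j i ∧ L i < L j then β * (L j - L i) * ρ j else 0) -
        if G.Adj i j ∧ L j < L i then β * (L i - L j) * ρ i else 0) := by
  have hlt (a b : Fin N) (c : ℝ) : β * L a - c < β * L b - c ↔ L a < L b := by
    rw [sub_lt_sub_iff_right, mul_lt_mul_iff_right₀ hβ]
  unfold fpe2RHS
  simp only [fun j => potential_add_log_eq Ψ hβ.ne' (hρ j) j, ← hL, hlt, ← Finset.sum_add_distrib]
  refine Finset.sum_congr rfl fun j _ => ?_
  simp only [G.adj_comm j i]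
  split_ifs <;> ring

theorem hasDerivAt_relEnt {N : ℕ} {ρ : ℝ → Fin N → ℝ} {ρ' μ : Fin N → ℝ} {t : ℝ}
    (hρ : ∀ i, HasDerivAt (fun s => ρ s i) (ρ' i) t) (hpos : ∀ i, ρ t i ≠ 0)
    (hμ : ∀ i, μ i ≠ 0) :
    HasDerivAt (fun s => relEnt (ρ s) μ)
      (∑ i, (Real.log (ρ t i / μ i) + 1) * ρ' i) t := by
  unfold relEnt
  refine HasDerivAt.fun_sum fun i _ => ?_
  have h := (hρ i).fun_mul (((hρ i).div_const (μ i)).log (div_ne_zero (hpos i) (hμ i)))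
  refine h.congr_deriv ?_
  have h₁ := hpos i
  have h₂ := hμ i
  field_simp

theorem fpe2_entropy_dissipation_identity {N : ℕ} (hN : 2 ≤ N)
    (G : SimpleGraph (Fin N)) [DecidableRel G.Adj] (hG : G.Connected)
    (Ψ : Fin N → ℝ) (β : ℝ) (hβ : 0 < β)
    (ρ : ℝ → Fin N → ℝ) (hsol : IsFPE2Sol G Ψ β ρ) :
    ∀ t, 0 < t →
      HasDerivAt (fun s => relEnt (ρ s) (gibbs Ψ β))
        (-(β * ∑ i, ∑ j,
            if G.Adj i j ∧ ρ t j / gibbs Ψ β j < ρ t i / gibbs Ψ β i then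
              (Real.log (ρ t i / gibbs Ψ β i) -
                Real.log (ρ t j / gibbs Ψ β j)) ^ 2 * ρ t i
            else 0)) t := by
  intro t ht
  have hpos := (hsol.1 t ht.le).1
  refine (hasDerivAt_relEnt (fun i => (hsol.2 t ht.le i).hasDerivAt (Ici_mem_nhds ht))
    (fun i => (hpos i).ne') (fun i => (gibbs_pos Ψ β i).ne')).congr_deriv ?_
  have hlog (i j : Fin N) : ρ t j / gibbs Ψ β j < ρ t i / gibbs Ψ β i ↔
      Real.log (ρ t j / gibbs Ψ β j) < Real.log (ρ t i / gibbs Ψ β i) :=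
    (Real.log_lt_log_iff (div_pos (hpos j) (gibbs_pos Ψ β j))
      (div_pos (hpos i) (gibbs_pos Ψ β i))).symm
  simp only [hlog, fpe2RHS_eq_sum_flow G Ψ hβ hpos (fun _ => rfl)]
  rw [sum_add_one_mul_sum_sub_swap (fun i => Real.log (ρ t i / gibbs Ψ β i))
    (fun i j => if G.Adj i j ∧
        Real.log (ρ t j / gibbs Ψ β j) < Real.log (ρ t i / gibbs Ψ β i) then
      β * (Real.log (ρ t i / gibbs Ψ β i) - Real.log (ρ t j / gibbs Ψ β j)) * ρ t i else 0)]
  simp only [Finset.mul_sum]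
  congr 1
  refine Finset.sum_congr rfl fun i _ => Finset.sum_congr rfl fun j _ => ?_
  split_ifs <;> ring
end

section
/- Let G = (V,E) be a connected simple graph on N ≥ 2 vertices, Ψ a potential on V, β > 0, and ρ* the Gibbs distribution. Let ρ(t) : [0,∞) → M be a solution of Fokker–Planck equation I, and set L(t) = Σ_{i=1}^N (ρ_i(t) − ρ*_i)²/ρ*_i and η_i(t) = (ρ_i(t) − ρ*_i)/ρ*_i. Then for every t > 0: dL/dt = −Σ_{{a_i,a_j}∈E, Ψ_j>Ψ_i} 2β (log(1+η_j(t)) − log(1+η_i(t)))(η_j(t) − η_i(t)) ρ_j(t) − Σ_{{a_i,a_j}∈E, Ψ_j=Ψ_i} 2β (η_j(t) − η_i(t))² · (ρ*_i + ρ*_j)/2. -/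
/-!
STATEMENT 9: Dissipation identity for the weighted L² norm along solutions of
Fokker–Planck equation I.  Edge sums over unordered edges with Ψ_j > Ψ_i are
written as double sums filtered by Ψ_i < Ψ_j (each such edge appears exactly
once); the edge sum over edges with Ψ_i = Ψ_j has a symmetric summand and is
written as half of the corresponding double sum.
-/

open Finset Real

/-- `η_i = (ρ_i − ρ*_i)/ρ*_i`. -/
noncomputable def etaOf {N : ℕ} (ρ ρstar : Fin N → ℝ) (i : Fin N) : ℝ :=
  (ρ i - ρstar i) / ρstar i

theorem gibbs_eq_of_eq {N : ℕ} {Ψ : Fin N → ℝ} (β : ℝ) {i j : Fin N} (h : Ψ i = Ψ j) :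
    gibbs Ψ β i = gibbs Ψ β j := by
  simp only [gibbs, h]

theorem log_gibbs {N : ℕ} (Ψ : Fin N → ℝ) (β : ℝ) (i : Fin N) :
    Real.log (gibbs Ψ β i) = -Ψ i / β - Real.log (∑ j, Real.exp (-Ψ j / β)) := by
  have hK : 0 < ∑ j, Real.exp (-Ψ j / β) :=
    Finset.sum_pos (fun _ _ => Real.exp_pos _) ⟨i, Finset.mem_univ i⟩
  rw [gibbs, Real.log_div (Real.exp_pos _).ne' hK.ne', Real.log_exp]

theorem one_add_etaOf {N : ℕ} {ρ ρstar : Fin N → ℝ} {i : Fin N} (h : ρstar i ≠ 0) :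
    1 + etaOf ρ ρstar i = ρ i / ρstar i := by
  rw [etaOf]
  field_simp
  ring

/-- The difference of chemical potentials along an edge is `β` times the difference of
`log (1 + η)`. -/
theorem chemicalPotential_sub {N : ℕ} (Ψ : Fin N → ℝ) {β : ℝ} (hβ : β ≠ 0) {ρ : Fin N → ℝ}
    (hρ : ∀ i, 0 < ρ i) (i j : Fin N) :
    (Ψ j + β * Real.log (ρ j)) - (Ψ i + β * Real.log (ρ i)) =
      β * (Real.log (1 + etaOf ρ (gibbs Ψ β) j) - Real.log (1 + etaOf ρ (gibbs Ψ β) i)) := by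
  have hg := fun k => (gibbs_pos Ψ β k).ne'
  rw [one_add_etaOf (hg j), one_add_etaOf (hg i), Real.log_div (hρ j).ne' (hg j),
    Real.log_div (hρ i).ne' (hg i), log_gibbs, log_gibbs]
  field_simp
  ring

/-- Summation by parts for the upwind part and the equal-potential part of the equation. -/
theorem sum_eta_mul_fpe1RHS {N : ℕ} (G : SimpleGraph (Fin N)) [DecidableRel G.Adj]
    (Ψ : Fin N → ℝ) {β : ℝ} (hβ : β ≠ 0) {ρ : Fin N → ℝ} (hρ : ∀ i, 0 < ρ i) :
    ∑ i, 2 * etaOf ρ (gibbs Ψ β) i * fpe1RHS G Ψ β ρ i =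
      -(∑ i, ∑ j, if G.Adj i j ∧ Ψ i < Ψ j then
            2 * β * (Real.log (1 + etaOf ρ (gibbs Ψ β) j) -
                Real.log (1 + etaOf ρ (gibbs Ψ β) i)) *
              (etaOf ρ (gibbs Ψ β) j - etaOf ρ (gibbs Ψ β) i) * ρ j
          else 0)
         - (1 / 2) * ∑ i, ∑ j, if G.Adj i j ∧ Ψ j = Ψ i then
            2 * β * (etaOf ρ (gibbs Ψ β) j - etaOf ρ (gibbs Ψ β) i) ^ 2 *
              ((gibbs Ψ β i + gibbs Ψ β j) / 2)
          else 0 := by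
  have hsub : ∀ i j, Ψ j = Ψ i → ρ j - ρ i =
      gibbs Ψ β i * (etaOf ρ (gibbs Ψ β) j - etaOf ρ (gibbs Ψ β) i) := by
    intro i j h
    have hg := (gibbs_pos Ψ β i).ne'
    rw [etaOf, etaOf, gibbs_eq_of_eq β h]
    field_simp
    ring
  simp only [fpe1RHS, chemicalPotential_sub Ψ hβ hρ]
  set η := etaOf ρ (gibbs Ψ β)
  set g := gibbs Ψ β with hgdef
  simp only [mul_add, Finset.sum_add_distrib, Finset.mul_sum]
  have hswap := Finset.sum_comm (s := Finset.univ) (t := Finset.univ) (f := fun i j =>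
    2 * η i * if G.Adj i j ∧ Ψ j < Ψ i then
      β * (Real.log (1 + η j) - Real.log (1 + η i)) * ρ i else 0)
  have hsymm := Finset.sum_comm (s := Finset.univ) (t := Finset.univ) (f := fun i j =>
    2 * η i * if G.Adj i j ∧ Ψ j = Ψ i then β * (ρ j - ρ i) else 0)
  have hupwind : (∑ i, ∑ j, 2 * η i * if G.Adj i j ∧ Ψ i < Ψ j then
        β * (Real.log (1 + η j) - Real.log (1 + η i)) * ρ j else 0) +
      (∑ i, ∑ j, 2 * η i * if G.Adj i j ∧ Ψ j < Ψ i then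
        β * (Real.log (1 + η j) - Real.log (1 + η i)) * ρ i else 0) =
      -∑ i, ∑ j, if G.Adj i j ∧ Ψ i < Ψ j then
        2 * β * (Real.log (1 + η j) - Real.log (1 + η i)) * (η j - η i) * ρ j else 0 := by
    rw [hswap]
    simp only [← Finset.sum_add_distrib, ← Finset.sum_neg_distrib]
    refine Finset.sum_congr rfl fun i _ => Finset.sum_congr rfl fun j _ => ?_
    simp only [G.adj_comm j i]
    split_ifs <;> ring
  have hequal : (∑ i, ∑ j, 2 * η i * if G.Adj i j ∧ Ψ j = Ψ i then β * (ρ j - ρ i) else 0) +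
      (∑ i, ∑ j, 2 * η i * if G.Adj i j ∧ Ψ j = Ψ i then β * (ρ j - ρ i) else 0) =
      -∑ i, ∑ j, if G.Adj i j ∧ Ψ j = Ψ i then
        2 * β * (η j - η i) ^ 2 * ((g i + g j) / 2) else 0 := by
    nth_rewrite 2 [hsymm]
    simp only [← Finset.sum_add_distrib, ← Finset.sum_neg_distrib]
    refine Finset.sum_congr rfl fun i _ => Finset.sum_congr rfl fun j _ => ?_
    simp only [G.adj_comm j i, eq_comm (a := Ψ i)]
    split_ifs with h
    · rw [hsub i j h.2, hsub j i h.2.symm, hgdef, gibbs_eq_of_eq β h.2]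
      ring
    · ring
  simp only [← Finset.mul_sum] at hupwind hequal ⊢
  linarith

theorem fpe1_L2_dissipation_identity {N : ℕ} (hN : 2 ≤ N)
    (G : SimpleGraph (Fin N)) [DecidableRel G.Adj] (hG : G.Connected)
    (Ψ : Fin N → ℝ) (β : ℝ) (hβ : 0 < β)
    (ρ : ℝ → Fin N → ℝ) (hsol : IsFPE1Sol G Ψ β ρ) :
    ∀ t, 0 < t →
      HasDerivAt (fun s => ∑ i, (ρ s i - gibbs Ψ β i) ^ 2 / gibbs Ψ β i)
        (-(∑ i, ∑ j, if G.Adj i j ∧ Ψ i < Ψ j then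
            2 * β * (Real.log (1 + etaOf (ρ t) (gibbs Ψ β) j) -
                Real.log (1 + etaOf (ρ t) (gibbs Ψ β) i)) *
              (etaOf (ρ t) (gibbs Ψ β) j - etaOf (ρ t) (gibbs Ψ β) i) * ρ t j
          else 0)
         - (1 / 2) * ∑ i, ∑ j, if G.Adj i j ∧ Ψ j = Ψ i then
            2 * β * (etaOf (ρ t) (gibbs Ψ β) j - etaOf (ρ t) (gibbs Ψ β) i) ^ 2 *
              ((gibbs Ψ β i + gibbs Ψ β j) / 2)
          else 0) t := by
  intro t ht
  have hpos := (hsol.1 t ht.le).1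
  rw [← sum_eta_mul_fpe1RHS G Ψ hβ.ne' hpos]
  refine HasDerivAt.fun_sum fun i _ => ?_
  have hρ := (hsol.2 t ht.le i).hasDerivAt (Ici_mem_nhds ht)
  have hd := ((hρ.sub_const (gibbs Ψ β i)).fun_pow 2).div_const (gibbs Ψ β i)
  refine hd.congr_deriv ?_
  rw [etaOf]
  push_cast
  ring
end

section
/- Let G = (V,E) be a connected simple graph on N ≥ 2 vertices, Ψ a potential on V, β > 0, and ρ* the Gibbs distribution. Let ρ(t) : [0,∞) → M be a solution of Fokker–Planck equation II, and set L(t) = Σ_{i=1}^N (ρ_i(t) − ρ*_i)²/ρ*_i and η_i(t) = (ρ_i(t) − ρ*_i)/ρ*_i. Then for every t > 0: dL/dt ≤ −2β (min_{1≤i≤N} ρ*_i) · Σ_{{a_i,a_j}∈E} (η_j(t) − η_i(t))². -/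
/-!
STATEMENT 10: Dissipation bound for the weighted L² norm along solutions of
Fokker–Planck equation II:
dL/dt ≤ −2β (min_i ρ*_i) Σ_{{a_i,a_j}∈E} (η_j − η_i)².
-/

open Finset Real

/-- Summing over ordered adjacent pairs counts each edge twice. -/
theorem SimpleGraph.sum_adj_eq_two_mul_sum_edgeFinset {V R : Type*} [Fintype V] [Semiring R]
    (G : SimpleGraph V) [DecidableRel G.Adj] (f : Sym2 V → R) :
    ∑ i, ∑ j, (if G.Adj i j then f s(i, j) else 0) = 2 * ∑ e ∈ G.edgeFinset, f e := by
  classical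
  have hdart : ∑ d : G.Dart, f d.edge = 2 * ∑ e ∈ G.edgeFinset, f e := by
    rw [← Finset.sum_fiberwise_of_maps_to (s := univ) (t := G.edgeFinset)
      (g := SimpleGraph.Dart.edge) (fun d _ => by
        rw [SimpleGraph.mem_edgeFinset]; exact d.edge_mem), Finset.mul_sum]
    refine Finset.sum_congr rfl fun e he => ?_
    rw [Finset.sum_congr rfl (g := fun _ => f e) fun d hd => by rw [(Finset.mem_filter.1 hd).2],
      Finset.sum_const, G.dart_edge_fiber_card e (SimpleGraph.mem_edgeFinset.1 he)]
    simp
  rw [← hdart, ← Fintype.sum_prod_type' (f := fun i j => if G.Adj i j then f s(i, j) else 0),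
    ← Finset.sum_filter]
  refine (Finset.sum_bij' (fun d _ => (d.fst, d.snd))
    (fun xy h => ⟨xy, (Finset.mem_filter.1 h).2⟩) ?_ ?_ ?_ ?_ ?_).symm <;> simp
  intro d
  rfl

/-- Discrete summation by parts against an antisymmetric kernel. -/
theorem two_mul_sum_mul_sum_of_antisymm {ι R : Type*} [Fintype ι] [CommRing R]
    (g : ι → R) (F : ι → ι → R) (hF : ∀ i j, F j i = -F i j) :
    2 * ∑ i, g i * ∑ j, F i j = ∑ i, ∑ j, (g i - g j) * F i j := by
  have hswap : ∑ i, ∑ j, g i * F i j = ∑ i, ∑ j, g j * -F i j := by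
    rw [Finset.sum_comm]
    exact Finset.sum_congr rfl fun i _ => Finset.sum_congr rfl fun j _ => by rw [hF i j]
  have hsplit : ∑ i, ∑ j, (g i - g j) * F i j =
      ∑ i, ∑ j, g i * F i j + ∑ i, ∑ j, g j * -F i j := by
    simp only [← Finset.sum_add_distrib]
    exact Finset.sum_congr rfl fun i _ => Finset.sum_congr rfl fun j _ => by ring
  rw [hsplit, ← hswap]
  simp only [← Finset.mul_sum]
  ring

/-- The chemical potential is `β log (ρ_i / ρ*_i)` up to an additive constant. -/
theorem chemical_potential_sub_eq {N : ℕ} (Ψ : Fin N → ℝ) {β : ℝ} (hβ : β ≠ 0)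
    {ρ : Fin N → ℝ} (hρ : ∀ i, 0 < ρ i) (i j : Fin N) :
    (Ψ j + β * Real.log (ρ j)) - (Ψ i + β * Real.log (ρ i)) =
      β * (Real.log (ρ j / gibbs Ψ β j) - Real.log (ρ i / gibbs Ψ β i)) := by
  have hK : (∑ k, Real.exp (-Ψ k / β)) ≠ 0 :=
    (Finset.sum_pos (fun _ _ => Real.exp_pos _) ⟨i, Finset.mem_univ i⟩).ne'
  have hlog (k : Fin N) : Real.log (ρ k / gibbs Ψ β k) =
      Real.log (ρ k) + Ψ k / β + Real.log (∑ l, Real.exp (-Ψ l / β)) := by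
    rw [Real.log_div (hρ k).ne' (gibbs_pos Ψ β k).ne', gibbs,
      Real.log_div (Real.exp_ne_zero _) hK, Real.log_exp]
    ring
  rw [hlog, hlog]
  field_simp
  ring

theorem etaOf_eq_div_sub_one {N : ℕ} (ρ : Fin N → ℝ) {ρstar : Fin N → ℝ} {i : Fin N}
    (h : ρstar i ≠ 0) : etaOf ρ ρstar i = ρ i / ρstar i - 1 := by
  rw [etaOf, sub_div, div_self h]

theorem mul_sq_sub_le_mul_log_sub {x y m q : ℝ} (hx : 0 < x) (hxy : x ≤ y) (hm : m ≤ q)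
    (hq : 0 < q) : m * (y - x) ^ 2 ≤ (y - x) * (Real.log y - Real.log x) * (q * y) := by
  have hy : 0 < y := hx.trans_le hxy
  have hlog : 1 - x / y ≤ Real.log y - Real.log x := by
    have := Real.one_sub_inv_le_log_of_pos (div_pos hy hx)
    rwa [inv_div, Real.log_div hy.ne' hx.ne'] at this
  calc m * (y - x) ^ 2 ≤ q * (y - x) ^ 2 := mul_le_mul_of_nonneg_right hm (sq_nonneg _)
    _ = (y - x) * (1 - x / y) * (q * y) := by field_simp
    _ ≤ (y - x) * (Real.log y - Real.log x) * (q * y) := by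
      have := sub_nonneg.2 hxy
      gcongr

/-- The upwind flux into the vertex `i` along the edge `{i, j}`. -/
noncomputable def fpe2Flux {N : ℕ} (G : SimpleGraph (Fin N)) [DecidableRel G.Adj]
    (Ψ : Fin N → ℝ) (β : ℝ) (ρ : Fin N → ℝ) (i j : Fin N) : ℝ :=
  (if G.Adj i j ∧ Ψ i + β * Real.log (ρ i) < Ψ j + β * Real.log (ρ j) then
      ((Ψ j + β * Real.log (ρ j)) - (Ψ i + β * Real.log (ρ i))) * ρ j else 0)
  + (if G.Adj i j ∧ Ψ j + β * Real.log (ρ j) < Ψ i + β * Real.log (ρ i) then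
      ((Ψ j + β * Real.log (ρ j)) - (Ψ i + β * Real.log (ρ i))) * ρ i else 0)

theorem fpe2RHS_eq_sum_flux {N : ℕ} (G : SimpleGraph (Fin N)) [DecidableRel G.Adj]
    (Ψ : Fin N → ℝ) (β : ℝ) (ρ : Fin N → ℝ) (i : Fin N) :
    fpe2RHS G Ψ β ρ i = ∑ j, fpe2Flux G Ψ β ρ i j :=
  Finset.sum_add_distrib.symm

theorem fpe2Flux_antisymm {N : ℕ} (G : SimpleGraph (Fin N)) [DecidableRel G.Adj]
    (Ψ : Fin N → ℝ) (β : ℝ) (ρ : Fin N → ℝ) (i j : Fin N) :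
    fpe2Flux G Ψ β ρ j i = -fpe2Flux G Ψ β ρ i j := by
  simp only [fpe2Flux, G.adj_comm j i]
  split_ifs <;> ring

theorem etaOf_sub_mul_fpe2Flux_le {N : ℕ} (G : SimpleGraph (Fin N)) [DecidableRel G.Adj]
    (Ψ : Fin N → ℝ) {β : ℝ} (hβ : 0 < β) {ρ : Fin N → ℝ} (hρ : ∀ i, 0 < ρ i)
    {m : ℝ} (hm : ∀ i, m ≤ gibbs Ψ β i) (i j : Fin N) :
    (etaOf ρ (gibbs Ψ β) i - etaOf ρ (gibbs Ψ β) j) * fpe2Flux G Ψ β ρ i j ≤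
      if G.Adj i j then
        -β * m * (etaOf ρ (gibbs Ψ β) j - etaOf ρ (gibbs Ψ β) i) ^ 2 else 0 := by
  by_cases hadj : G.Adj i j
  · have hg (k : Fin N) := gibbs_pos Ψ β k
    have hr (k : Fin N) : 0 < ρ k / gibbs Ψ β k := div_pos (hρ k) (hg k)
    have hpot := chemical_potential_sub_eq Ψ hβ.ne' hρ i j
    have hρr (k : Fin N) : ρ k = gibbs Ψ β k * (ρ k / gibbs Ψ β k) :=
      (mul_div_cancel₀ (ρ k) (hg k).ne').symm
    simp only [etaOf_eq_div_sub_one ρ (hg _).ne', fpe2Flux, hadj, true_and, if_true, hpot]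
    rcases lt_trichotomy (ρ i / gibbs Ψ β i) (ρ j / gibbs Ψ β j) with h | h | h
    · have hlt := mul_pos hβ (sub_pos.2 (Real.log_lt_log (hr i) h))
      rw [← hpot, sub_pos] at hlt
      rw [if_pos hlt, if_neg hlt.not_gt]
      have key := mul_le_mul_of_nonneg_left
        (mul_sq_sub_le_mul_log_sub (hr i) h.le (hm j) (hg j)) hβ.le
      rw [← hρr] at key
      linarith
    · simp [h]
    · have hlt := mul_pos hβ (sub_pos.2 (Real.log_lt_log (hr j) h))
      rw [← chemical_potential_sub_eq Ψ hβ.ne' hρ j i, sub_pos] at hlt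
      rw [if_pos hlt, if_neg hlt.not_gt]
      have key := mul_le_mul_of_nonneg_left
        (mul_sq_sub_le_mul_log_sub (hr j) h.le (hm i) (hg i)) hβ.le
      rw [← hρr] at key
      linarith
  · simp [fpe2Flux, hadj]

theorem fpe2_L2_dissipation_bound {N : ℕ} (hN : 2 ≤ N)
    (G : SimpleGraph (Fin N)) [DecidableRel G.Adj] (hG : G.Connected)
    (Ψ : Fin N → ℝ) (β : ℝ) (hβ : 0 < β)
    (ρ : ℝ → Fin N → ℝ) (hsol : IsFPE2Sol G Ψ β ρ) :
    ∀ t, 0 < t →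
      deriv (fun s => ∑ i, (ρ s i - gibbs Ψ β i) ^ 2 / gibbs Ψ β i) t ≤
        -2 * β * (⨅ i, gibbs Ψ β i) *
          ∑ e ∈ G.edgeFinset,
            Sym2.lift ⟨fun i j =>
              (etaOf (ρ t) (gibbs Ψ β) j - etaOf (ρ t) (gibbs Ψ β) i) ^ 2,
              fun a b => by ring⟩ e := by
  intro t ht
  have hρ := (hsol.1 t ht.le).1
  set η := etaOf (ρ t) (gibbs Ψ β) with hη
  have hm (i : Fin N) : (⨅ i, gibbs Ψ β i) ≤ gibbs Ψ β i :=
    ciInf_le (Set.finite_range _).bddBelow i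
  have hder : HasDerivAt (fun s => ∑ i, (ρ s i - gibbs Ψ β i) ^ 2 / gibbs Ψ β i)
      (2 * ∑ i, η i * ∑ j, fpe2Flux G Ψ β (ρ t) i j) t := by
    rw [Finset.mul_sum]
    refine HasDerivAt.fun_sum fun i _ => ?_
    have h := (hsol.2 t ht.le i).hasDerivAt (Ici_mem_nhds ht)
    refine (((h.sub_const (gibbs Ψ β i)).pow 2).div_const (gibbs Ψ β i)).congr_deriv ?_
    rw [fpe2RHS_eq_sum_flux, hη, etaOf]
    push_cast
    ring
  rw [hder.deriv, two_mul_sum_mul_sum_of_antisymm _ _ (fpe2Flux_antisymm G Ψ β (ρ t))]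
  calc
    _ ≤ ∑ i, ∑ j, if G.Adj i j then -β * (⨅ i, gibbs Ψ β i) * (η j - η i) ^ 2 else 0 :=
      Finset.sum_le_sum fun i _ => Finset.sum_le_sum fun j _ =>
        etaOf_sub_mul_fpe2Flux_le G Ψ hβ hρ hm i j
    _ = -β * (⨅ i, gibbs Ψ β i) * ∑ i, ∑ j, if G.Adj i j then (η j - η i) ^ 2 else 0 := by
      simp only [Finset.mul_sum, mul_ite, mul_zero]
    _ = _ := by
      have h := G.sum_adj_eq_two_mul_sum_edgeFinset
        (Sym2.lift ⟨fun i j => (η j - η i) ^ 2, fun a b => by ring⟩)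
      simp only [Sym2.lift_mk] at h
      rw [h]
      ring
end
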